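/- arXiv:1902.00412 — 5 statements merged into one kernel-verified Lean document; each statement's English description precedes it below -/
import Mathlib

section
/- (Variance decomposition for the simple cut-off.) Let 0 < ε ≤ δ with c_δ > 0 and c_ε > 0, and let f: T → ℝ satisfy ∫ f² dπ_ε < ∞. Set h(θ,y) = 1{d(y,y*) ≤ ε} f(θ), w̄(θ) = L_ε(θ)/L_δ(θ) (defined π_δ-a.e. since L_δ > 0 π_δ-a.e.), and f_w = f·w̄. Then ∫ h dπ̃_δ = ∫ f_w dπ_δ, ∫ h² dπ̃_δ = ∫ f² w̄ dπ_δ, and hence Var_{π̃_δ}(h) = Var_{π_δ}(f_w) + ∫ w̄(θ)(1 − w̄(θ)) f(θ)² π_δ(dθ). -/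
open MeasureTheory ProbabilityTheory
open scoped ENNReal

noncomputable section

namespace ABCsimple

variable {T Y : Type*} [MeasurableSpace T] [MeasurableSpace Y]

/-- Simple cut-off kernel value `K_ε(y) = 1{d(y,y*) ≤ ε}`. -/
def K (d : Y → ℝ) (ε : ℝ) (y : Y) : ℝ := if d y ≤ ε then 1 else 0

/-- ABC likelihood `L_ε(θ) = ∫ K_ε(y) g(θ,dy)`. -/
def L (g : Kernel T Y) (d : Y → ℝ) (ε : ℝ) (θ : T) : ℝ := ∫ y, K d ε y ∂(g θ)

/-- Normalising constant `c_ε = ∫ pr(θ) L_ε(θ) ν(dθ)`. -/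
def c (ν : Measure T) (pr : T → ℝ) (g : Kernel T Y) (d : Y → ℝ) (ε : ℝ) : ℝ :=
  ∫ θ, pr θ * L g d ε θ ∂ν

/-- ABC posterior `π_ε(dθ) = c_ε⁻¹ pr(θ) L_ε(θ) ν(dθ)`. -/
def piPost (ν : Measure T) (pr : T → ℝ) (g : Kernel T Y) (d : Y → ℝ) (ε : ℝ) : Measure T :=
  (ENNReal.ofReal (c ν pr g d ε))⁻¹ •
    ν.withDensity (fun θ => ENNReal.ofReal (pr θ * L g d ε θ))

/-- Joint ABC target `π̃_ε(dθ,dy) = c_ε⁻¹ pr(θ) K_ε(y) g(θ,dy) ν(dθ)`. -/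
def piJoint (ν : Measure T) (pr : T → ℝ) (g : Kernel T Y) (d : Y → ℝ) (ε : ℝ) :
    Measure (T × Y) :=
  (ENNReal.ofReal (c ν pr g d ε))⁻¹ •
    (ν ⊗ₘ g).withDensity (fun p => ENNReal.ofReal (pr p.1 * K d ε p.2))

/-- `w̄(θ) = L_ε(θ)/L_δ(θ)`. -/
def wbar (g : Kernel T Y) (d : Y → ℝ) (δ ε : ℝ) (θ : T) : ℝ := L g d ε θ / L g d δ θ

end ABCsimple

namespace ABCsimple

variable {T Y : Type*} [MeasurableSpace T] [MeasurableSpace Y]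

omit [MeasurableSpace Y] in
lemma K_nonneg (d : Y → ℝ) (ε : ℝ) (y : Y) : 0 ≤ K d ε y := by
  unfold K; split_ifs <;> norm_num

omit [MeasurableSpace Y] in
lemma K_sq (d : Y → ℝ) (ε : ℝ) (y : Y) : K d ε y ^ 2 = K d ε y := by
  unfold K; split_ifs <;> norm_num

omit [MeasurableSpace Y] in
lemma K_eq_indicator (d : Y → ℝ) (ε : ℝ) : K d ε = {y | d y ≤ ε}.indicator 1 := by
  ext y; simp [K, Set.indicator]

lemma measurableSet_cutoff {d : Y → ℝ} (hd : Measurable d) (ε : ℝ) :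
    MeasurableSet {y | d y ≤ ε} := hd measurableSet_Iic

lemma measurableSet_snd_cutoff {d : Y → ℝ} (hd : Measurable d) (ε : ℝ) :
    MeasurableSet {p : T × Y | d p.2 ≤ ε} :=
  measurable_snd (measurableSet_cutoff hd ε)

lemma measurable_K {d : Y → ℝ} (hd : Measurable d) (ε : ℝ) : Measurable (K d ε) := by
  rw [K_eq_indicator]
  exact measurable_one.indicator (measurableSet_cutoff hd ε)

lemma L_eq_measureReal (g : Kernel T Y) {d : Y → ℝ} (hd : Measurable d) (ε : ℝ) (θ : T) :
    L g d ε θ = (g θ).real {y | d y ≤ ε} := by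
  rw [L, K_eq_indicator, integral_indicator_one (measurableSet_cutoff hd ε)]

lemma ofReal_L (g : Kernel T Y) [IsMarkovKernel g] {d : Y → ℝ} (hd : Measurable d) (ε : ℝ)
    (θ : T) : ENNReal.ofReal (L g d ε θ) = ∫⁻ y, ENNReal.ofReal (K d ε y) ∂(g θ) := by
  refine ofReal_integral_eq_lintegral_ofReal ?_ (ae_of_all _ (K_nonneg d ε))
  rw [K_eq_indicator]
  exact (integrable_const (1 : ℝ)).indicator (measurableSet_cutoff hd ε)

lemma L_nonneg (g : Kernel T Y) (d : Y → ℝ) (ε : ℝ) (θ : T) : 0 ≤ L g d ε θ :=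
  integral_nonneg (K_nonneg d ε)

lemma L_mono (g : Kernel T Y) [IsMarkovKernel g] {d : Y → ℝ} (hd : Measurable d) {ε δ : ℝ}
    (h : ε ≤ δ) (θ : T) : L g d ε θ ≤ L g d δ θ := by
  rw [L_eq_measureReal g hd, L_eq_measureReal g hd]
  exact measureReal_mono fun y hy => le_trans hy h

lemma measurable_L (g : Kernel T Y) {d : Y → ℝ} (hd : Measurable d) (ε : ℝ) :
    Measurable (L g d ε) := by
  simp_rw [funext (L_eq_measureReal g hd ε), Measure.real]
  exact (g.measurable_coe (measurableSet_cutoff hd ε)).ennreal_toReal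

lemma wbar_nonneg (g : Kernel T Y) (d : Y → ℝ) (δ ε : ℝ) (θ : T) : 0 ≤ wbar g d δ ε θ :=
  div_nonneg (L_nonneg g d ε θ) (L_nonneg g d δ θ)

lemma wbar_le_one (g : Kernel T Y) [IsMarkovKernel g] {d : Y → ℝ} (hd : Measurable d) {ε δ : ℝ}
    (h : ε ≤ δ) (θ : T) : wbar g d δ ε θ ≤ 1 :=
  div_le_one_of_le₀ (L_mono g hd h θ) (L_nonneg g d δ θ)

lemma L_mul_wbar (g : Kernel T Y) [IsMarkovKernel g] {d : Y → ℝ} (hd : Measurable d) {ε δ : ℝ}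
    (h : ε ≤ δ) (θ : T) : L g d δ θ * wbar g d δ ε θ = L g d ε θ :=
  mul_div_cancel_of_imp' fun h0 =>
    le_antisymm (h0 ▸ L_mono g hd h θ) (L_nonneg g d ε θ)

lemma measurable_wbar (g : Kernel T Y) {d : Y → ℝ} (hd : Measurable d) (δ ε : ℝ) :
    Measurable (wbar g d δ ε) :=
  (measurable_L g hd ε).div (measurable_L g hd δ)

section Marginal

variable (ν : Measure T) [SigmaFinite ν] {pr : T → ℝ} (g : Kernel T Y) [IsMarkovKernel g]
  {d : Y → ℝ}

lemma map_fst_withDensity (hpr : Measurable pr) (hpr0 : ∀ θ, 0 ≤ pr θ) (hd : Measurable d)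
    (ε : ℝ) :
    ((ν ⊗ₘ g).withDensity (fun p => ENNReal.ofReal (pr p.1 * K d ε p.2))).map Prod.fst
      = ν.withDensity (fun θ => ENNReal.ofReal (pr θ * L g d ε θ)) := by
  have hK := measurable_K hd ε
  ext s hs
  rw [Measure.map_apply measurable_fst hs, withDensity_apply _ (measurable_fst hs),
    withDensity_apply _ hs, ← Set.prod_univ,
    Measure.setLIntegral_compProd (by fun_prop) hs MeasurableSet.univ]
  refine lintegral_congr fun θ => ?_
  simp_rw [ENNReal.ofReal_mul (hpr0 θ), Measure.restrict_univ]
  rw [lintegral_const_mul _ (by fun_prop), ofReal_L g hd]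

omit [SigmaFinite ν] [IsMarkovKernel g] in
lemma restrict_withDensity_cutoff (hd : Measurable d) {ε δ : ℝ} (h : ε ≤ δ) :
    ((ν ⊗ₘ g).withDensity (fun p => ENNReal.ofReal (pr p.1 * K d δ p.2))).restrict
        {p | d p.2 ≤ ε}
      = (ν ⊗ₘ g).withDensity (fun p => ENNReal.ofReal (pr p.1 * K d ε p.2)) := by
  have hs : MeasurableSet {p : T × Y | d p.2 ≤ ε} := measurableSet_snd_cutoff hd ε
  rw [restrict_withDensity hs, ← withDensity_indicator hs]
  congr 1
  ext p
  by_cases hp : d p.2 ≤ ε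
  · simp [K, hp, hp.trans h]
  · simp [K, hp]

lemma map_fst_restrict_piJoint (hpr : Measurable pr) (hpr0 : ∀ θ, 0 ≤ pr θ) (hd : Measurable d)
    {ε δ : ℝ} (h : ε ≤ δ) :
    ((piJoint ν pr g d δ).restrict {p | d p.2 ≤ ε}).map Prod.fst
      = (ENNReal.ofReal (c ν pr g d δ))⁻¹ •
        ν.withDensity (fun θ => ENNReal.ofReal (pr θ * L g d ε θ)) := by
  rw [piJoint, Measure.restrict_smul, Measure.map_smul, restrict_withDensity_cutoff ν g hd h,
    map_fst_withDensity ν g hpr hpr0 hd]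

omit [SigmaFinite ν] in
lemma piPost_withDensity_wbar (hpr : Measurable pr) (hpr0 : ∀ θ, 0 ≤ pr θ) (hd : Measurable d)
    {ε δ : ℝ} (h : ε ≤ δ) :
    (piPost ν pr g d δ).withDensity (fun θ => ENNReal.ofReal (wbar g d δ ε θ))
      = (ENNReal.ofReal (c ν pr g d δ))⁻¹ •
        ν.withDensity (fun θ => ENNReal.ofReal (pr θ * L g d ε θ)) := by
  have hL := measurable_L g hd δ
  have hw := measurable_wbar g hd δ ε
  rw [piPost, withDensity_smul_measure, ← withDensity_mul _ (by fun_prop) (by fun_prop)]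
  congr 2
  ext θ
  rw [Pi.mul_apply, ← ENNReal.ofReal_mul (mul_nonneg (hpr0 θ) (L_nonneg g d δ θ)), mul_assoc,
    L_mul_wbar g hd h]

omit [MeasurableSpace T] [MeasurableSpace Y] in
lemma cutoff_mul_eq_indicator (u : T → ℝ) (ε : ℝ) :
    (fun p : T × Y => K d ε p.2 * u p.1)
      = {p : T × Y | d p.2 ≤ ε}.indicator (fun p => u p.1) := by
  ext p; by_cases hp : d p.2 ≤ ε <;> simp [K, hp]

lemma integral_piJoint_cutoff_mul (hpr : Measurable pr) (hpr0 : ∀ θ, 0 ≤ pr θ)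
    (hd : Measurable d) {ε δ : ℝ} (h : ε ≤ δ) {u : T → ℝ} (hu : Measurable u) :
    ∫ p, K d ε p.2 * u p.1 ∂(piJoint ν pr g d δ)
      = ∫ θ, u θ * wbar g d δ ε θ ∂(piPost ν pr g d δ) := by
  have hw := measurable_wbar g hd δ ε
  rw [cutoff_mul_eq_indicator, integral_indicator (measurableSet_snd_cutoff hd ε),
    ← integral_map (f := u) measurable_fst.aemeasurable hu.aestronglyMeasurable,
    map_fst_restrict_piJoint ν g hpr hpr0 hd h, ← piPost_withDensity_wbar ν g hpr hpr0 hd h,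
    integral_withDensity_eq_integral_toReal_smul (by fun_prop) (by simp)]
  refine integral_congr_ae (ae_of_all _ fun θ => ?_)
  simp [ENNReal.toReal_ofReal (wbar_nonneg g d δ ε θ), mul_comm]

lemma integrable_piJoint_cutoff_mul_iff (hpr : Measurable pr) (hpr0 : ∀ θ, 0 ≤ pr θ)
    (hd : Measurable d) {ε δ : ℝ} (h : ε ≤ δ) {u : T → ℝ} (hu : Measurable u) :
    Integrable (fun p : T × Y => K d ε p.2 * u p.1) (piJoint ν pr g d δ)
      ↔ Integrable u ((ENNReal.ofReal (c ν pr g d δ))⁻¹ •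
        ν.withDensity (fun θ => ENNReal.ofReal (pr θ * L g d ε θ))) := by
  rw [cutoff_mul_eq_indicator,
    integrable_indicator_iff (measurableSet_snd_cutoff hd ε), IntegrableOn,
    ← map_fst_restrict_piJoint ν g hpr hpr0 hd h,
    integrable_map_measure hu.aestronglyMeasurable measurable_fst.aemeasurable]
  rfl

omit [SigmaFinite ν] in
lemma integrable_mul_wbar_iff (hpr : Measurable pr) (hpr0 : ∀ θ, 0 ≤ pr θ)
    (hd : Measurable d) {ε δ : ℝ} (h : ε ≤ δ) {u : T → ℝ} :
    Integrable (fun θ => u θ * wbar g d δ ε θ) (piPost ν pr g d δ)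
      ↔ Integrable u ((ENNReal.ofReal (c ν pr g d δ))⁻¹ •
        ν.withDensity (fun θ => ENNReal.ofReal (pr θ * L g d ε θ))) := by
  have hw := measurable_wbar g hd δ ε
  rw [← piPost_withDensity_wbar ν g hpr hpr0 hd h,
    integrable_withDensity_iff (by fun_prop) (by simp)]
  simp_rw [ENNReal.toReal_ofReal (wbar_nonneg g d δ ε _)]

omit [SigmaFinite ν] [IsMarkovKernel g] in
lemma isProbabilityMeasure_piPost (hpr0 : ∀ θ, 0 ≤ pr θ) {δ : ℝ} (hc : 0 < c ν pr g d δ) :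
    IsProbabilityMeasure (piPost ν pr g d δ) := by
  have hint : Integrable (fun θ => pr θ * L g d δ θ) ν := not_imp_comm.1 integral_undef hc.ne'
  have h0 : ENNReal.ofReal (c ν pr g d δ) ≠ 0 := by simpa using hc
  constructor
  rw [piPost, Measure.smul_apply, withDensity_apply _ MeasurableSet.univ, Measure.restrict_univ,
    ← ofReal_integral_eq_lintegral_ofReal hint
      (ae_of_all _ fun θ => mul_nonneg (hpr0 θ) (L_nonneg g d δ θ))]
  exact ENNReal.inv_mul_cancel h0 ENNReal.ofReal_ne_top

lemma isProbabilityMeasure_piJoint (hpr : Measurable pr) (hpr0 : ∀ θ, 0 ≤ pr θ)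
    (hd : Measurable d) {δ : ℝ} (hc : 0 < c ν pr g d δ) :
    IsProbabilityMeasure (piJoint ν pr g d δ) := by
  have hmap : (piJoint ν pr g d δ).map Prod.fst = piPost ν pr g d δ := by
    rw [piJoint, Measure.map_smul, map_fst_withDensity ν g hpr hpr0 hd, piPost]
  have : IsProbabilityMeasure ((piJoint ν pr g d δ).map Prod.fst) :=
    hmap ▸ isProbabilityMeasure_piPost ν g hpr0 hc
  exact Measure.isProbabilityMeasure_of_map Prod.fst

end Marginal

end ABCsimple

open ABCsimple

/-- variance decomposition for the simple cut-off. -/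
theorem stmt2 {T Y : Type*} [MeasurableSpace T] [MeasurableSpace Y]
    (ν : Measure T) [SigmaFinite ν]
    (pr : T → ℝ) (hpr_meas : Measurable pr) (hpr_nonneg : ∀ θ, 0 ≤ pr θ)
    (hpr_prob : ∫ θ, pr θ ∂ν = 1)
    (g : Kernel T Y) [IsMarkovKernel g]
    (d : Y → ℝ) (hd_meas : Measurable d) (hd_nonneg : ∀ y, 0 ≤ d y)
    (ε δ : ℝ) (hε : 0 < ε) (hεδ : ε ≤ δ)
    (hcδ : 0 < c ν pr g d δ) (hcε : 0 < c ν pr g d ε)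
    (f : T → ℝ) (hf_meas : Measurable f)
    (hf2 : ∫⁻ θ, ENNReal.ofReal ((f θ) ^ 2) ∂(piPost ν pr g d ε) < ⊤) :
    (∫ p, K d ε p.2 * f p.1 ∂(piJoint ν pr g d δ)
        = ∫ θ, f θ * wbar g d δ ε θ ∂(piPost ν pr g d δ)) ∧
    (∫ p, (K d ε p.2 * f p.1) ^ 2 ∂(piJoint ν pr g d δ)
        = ∫ θ, (f θ) ^ 2 * wbar g d δ ε θ ∂(piPost ν pr g d δ)) ∧
    (variance (fun p : T × Y => K d ε p.2 * f p.1) (piJoint ν pr g d δ)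
        = variance (fun θ => f θ * wbar g d δ ε θ) (piPost ν pr g d δ)
          + ∫ θ, wbar g d δ ε θ * (1 - wbar g d δ ε θ) * (f θ) ^ 2
              ∂(piPost ν pr g d δ)) := by
  have hw := measurable_wbar g hd_meas δ ε
  have hK := measurable_K hd_meas ε
  have hw0 := wbar_nonneg g d δ ε
  have hw1 := wbar_le_one g hd_meas hεδ
  have := isProbabilityMeasure_piPost ν g hpr_nonneg hcδ
  have := isProbabilityMeasure_piJoint ν g hpr_meas hpr_nonneg hd_meas hcδ
  have hsq (p : T × Y) : (K d ε p.2 * f p.1) ^ 2 = K d ε p.2 * f p.1 ^ 2 := by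
    rw [mul_pow, K_sq]
  have hmean := integral_piJoint_cutoff_mul ν g hpr_meas hpr_nonneg hd_meas hεδ hf_meas
  have hsecond : ∫ p, (K d ε p.2 * f p.1) ^ 2 ∂(piJoint ν pr g d δ)
      = ∫ θ, (f θ) ^ 2 * wbar g d δ ε θ ∂(piPost ν pr g d δ) := by
    simp_rw [hsq]
    exact integral_piJoint_cutoff_mul ν g hpr_meas hpr_nonneg hd_meas hεδ (hf_meas.pow_const 2)
  have hf_int : Integrable (fun θ => f θ ^ 2) ((ENNReal.ofReal (c ν pr g d δ))⁻¹ •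
      ν.withDensity (fun θ => ENNReal.ofReal (pr θ * L g d ε θ))) := by
    refine Integrable.smul_measure ⟨by fun_prop, ?_⟩ (by simpa using hcδ)
    rw [hasFiniteIntegral_iff_ofReal (ae_of_all _ fun θ => sq_nonneg (f θ))]
    rw [piPost, lintegral_smul_measure, smul_eq_mul] at hf2
    exact ENNReal.lt_top_of_mul_ne_top_right hf2.ne (by simp)
  have hX : MemLp (fun p : T × Y => K d ε p.2 * f p.1) 2 (piJoint ν pr g d δ) := by
    rw [memLp_two_iff_integrable_sq (by fun_prop)]
    simp_rw [hsq]
    exact (integrable_piJoint_cutoff_mul_iff ν g hpr_meas hpr_nonneg hd_meas hεδ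
      (hf_meas.pow_const 2)).2 hf_int
  have hf2w : Integrable (fun θ => f θ ^ 2 * wbar g d δ ε θ) (piPost ν pr g d δ) :=
    (integrable_mul_wbar_iff ν g hpr_meas hpr_nonneg hd_meas hεδ).2 hf_int
  have hfw2 : Integrable (fun θ => (f θ * wbar g d δ ε θ) ^ 2) (piPost ν pr g d δ) := by
    refine hf2w.mono' (by fun_prop) (ae_of_all _ fun θ => ?_)
    rw [Real.norm_of_nonneg (sq_nonneg _), mul_pow]
    exact mul_le_mul_of_nonneg_left (pow_le_of_le_one (hw0 θ) (hw1 θ) two_ne_zero) (sq_nonneg _)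
  have hZ : MemLp (fun θ => f θ * wbar g d δ ε θ) 2 (piPost ν pr g d δ) :=
    (memLp_two_iff_integrable_sq (by fun_prop)).2 hfw2
  have hdiff : ∫ θ, wbar g d δ ε θ * (1 - wbar g d δ ε θ) * (f θ) ^ 2 ∂(piPost ν pr g d δ)
      = ∫ θ, (f θ) ^ 2 * wbar g d δ ε θ ∂(piPost ν pr g d δ)
        - ∫ θ, (f θ * wbar g d δ ε θ) ^ 2 ∂(piPost ν pr g d δ) := by
    rw [← integral_sub hf2w hfw2]
    congr 1 with θ
    ring
  refine ⟨hmean, hsecond, ?_⟩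
  rw [variance_eq_sub hX, variance_eq_sub hZ, hdiff, hmean]
  simp only [Pi.pow_apply]
  rw [hsecond]
  ring
end
end

section
/- (Theorem 3: Peskun-type bound for post-corrected asymptotic variance.) Let 0 < ε ≤ δ with c_δ > 0 and c_ε > 0, and let f: T → ℝ satisfy ∫ f² dπ_ε < ∞. Write f̄(θ) = f(θ) − ∫ f dπ_ε and h̄(θ,y) = w_{δ,ε}(y) f̄(θ). Define the asymptotic variances σ²_{δ,ε}(f) = (c_δ/c_ε)² [ ∫ h̄² dπ̃_δ + 2 Σ_{k≥1} ∫ h̄ (P̃_δ^k h̄) dπ̃_δ ] and σ²_ε(f) = ∫ f̄² dπ̃_ε + 2 Σ_{k≥1} ∫ f̄ (P̃_ε^k f̄) dπ̃_ε (with f̄ regarded as a function of (θ,y) through θ), assuming both series converge absolutely. Then σ²_{δ,ε}(f) ≤ (c_δ/c_ε) [ σ²_ε(f) + ∫ f̄(θ)² (1 − w_{δ,ε}(y)) π̃_ε(dθ,dy) ]. -/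
open MeasureTheory ProbabilityTheory
open scoped ENNReal

noncomputable section

namespace ABC0

variable {T Y : Type*} [MeasurableSpace T] [MeasurableSpace Y]

/-- Kernel (cut-off) value `K_ε(y) = φ(d(y,y*)/ε)`. -/
def K (φ : ℝ → ℝ) (d : Y → ℝ) (ε : ℝ) (y : Y) : ℝ := φ (d y / ε)

/-- ABC likelihood `L_ε(θ) = ∫ K_ε(y) g(θ,dy)`. -/
def L (g : Kernel T Y) (φ : ℝ → ℝ) (d : Y → ℝ) (ε : ℝ) (θ : T) : ℝ :=
  ∫ y, K φ d ε y ∂(g θ)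

/-- Normalising constant `c_ε = ∫ pr(θ) L_ε(θ) ν(dθ)`. -/
def c (ν : Measure T) (pr : T → ℝ) (g : Kernel T Y) (φ : ℝ → ℝ) (d : Y → ℝ) (ε : ℝ) : ℝ :=
  ∫ θ, pr θ * L g φ d ε θ ∂ν

/-- ABC posterior `π_ε(dθ) = c_ε⁻¹ pr(θ) L_ε(θ) ν(dθ)`. -/
def piPost (ν : Measure T) (pr : T → ℝ) (g : Kernel T Y) (φ : ℝ → ℝ) (d : Y → ℝ) (ε : ℝ) :
    Measure T :=
  (ENNReal.ofReal (c ν pr g φ d ε))⁻¹ •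
    ν.withDensity (fun θ => ENNReal.ofReal (pr θ * L g φ d ε θ))

/-- Joint ABC target `π̃_ε(dθ,dy) = c_ε⁻¹ pr(θ) K_ε(y) g(θ,dy) ν(dθ)`. -/
def piJoint (ν : Measure T) (pr : T → ℝ) (g : Kernel T Y) (φ : ℝ → ℝ) (d : Y → ℝ) (ε : ℝ) :
    Measure (T × Y) :=
  (ENNReal.ofReal (c ν pr g φ d ε))⁻¹ •
    (ν ⊗ₘ g).withDensity (fun p => ENNReal.ofReal (pr p.1 * K φ d ε p.2))

/-- Importance weight `w_{δ,ε}(y) = K_ε(y)/K_δ(y)` if `K_δ(y) > 0`, and `0` otherwise. -/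
def w (φ : ℝ → ℝ) (d : Y → ℝ) (δ ε : ℝ) (y : Y) : ℝ :=
  if 0 < K φ d δ y then K φ d ε y / K φ d δ y else 0


/-- Metropolis–Hastings acceptance probability of ABC-MCMC(t). -/
def accept (pr : T → ℝ) (q : T → T → ℝ) (φ : ℝ → ℝ) (d : Y → ℝ) (t : ℝ) (p p' : T × Y) : ℝ :=
  min 1 (pr p'.1 * q p'.1 p.1 * K φ d t p'.2 / (pr p.1 * q p.1 p'.1 * K φ d t p.2))

/-- The transition operator `P̃_t` of ABC-MCMC(t) acting on functions. -/
def MHop (ν : Measure T) (g : Kernel T Y) (pr : T → ℝ) (q : T → T → ℝ) (φ : ℝ → ℝ)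
    (d : Y → ℝ) (t : ℝ) (h : T × Y → ℝ) : T × Y → ℝ :=
  fun p =>
    (∫ ϑ, q p.1 ϑ * ∫ y', accept pr q φ d t p (ϑ, y') * h (ϑ, y') ∂(g ϑ) ∂ν)
      + (1 - ∫ ϑ, q p.1 ϑ * ∫ y', accept pr q φ d t p (ϑ, y') ∂(g ϑ) ∂ν) * h p

end ABC0

namespace ABC0

open scoped RealInnerProductSpace

section Hilbert

variable {H : Type*} [NormedAddCommGroup H] [InnerProductSpace ℝ H]

theorem real_inner_clm_self_le {P : H →L[ℝ] H} (hP : ‖P‖ ≤ 1) (x : H) : ⟪x, P x⟫ ≤ ⟪x, x⟫ := by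
  have h := real_inner_le_norm x (P x)
  have h' := P.le_of_opNorm_le hP x
  rw [real_inner_self_eq_norm_sq]
  nlinarith [norm_nonneg x]

/-- The Abel-regularised Poisson equation `v - r P v = h` has a solution, and `⟪h, v⟫` is the
power series in `r` whose coefficients are the autocovariances `⟪h, P ^ k h⟫`. -/
theorem exists_abel_resolvent [CompleteSpace H] {P : H →L[ℝ] H} (hP : ‖P‖ ≤ 1) (h : H)
    {r : ℝ} (hr0 : 0 ≤ r) (hr1 : r < 1) :
    ∃ v : H, v - r • P v = h ∧ ⟪h, v⟫ = ∑' k : ℕ, ⟪h, (P ^ k) h⟫ * r ^ k := by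
  have hn : ‖r • P‖ < 1 := by
    rw [norm_smul, Real.norm_of_nonneg hr0]
    nlinarith [norm_nonneg P]
  have hs : HasSum (fun k : ℕ => ((r • P) ^ k) h) ((∑' k : ℕ, (r • P) ^ k) h) :=
    (summable_geometric_of_norm_lt_one hn).hasSum.mapL (ContinuousLinearMap.apply ℝ H h)
  refine ⟨(∑' k : ℕ, (r • P) ^ k) h, ?_, ?_⟩
  · have := congrArg (fun A : H →L[ℝ] H => A h) (mul_neg_geom_series (r • P) hn)
    simpa [sub_mul] using this
  · have h2 := hs.mapL (innerSL ℝ h)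
    rw [← innerSL_apply_apply ℝ h, ← h2.tsum_eq]
    refine tsum_congr fun k => ?_
    simp [smul_pow, mul_comm]

/-- Upper bound on the concave quadratic functional whose maximum is attained at the solution of
`v - r P v = f`. -/
theorem two_inner_sub_form_le {P : H →L[ℝ] H} (hP : ‖P‖ ≤ 1)
    (hsymm : ∀ x y, ⟪P x, y⟫ = ⟪x, P y⟫) {r : ℝ} (hr0 : 0 ≤ r) (hr1 : r ≤ 1) {f v : H}
    (hv : v - r • P v = f) (u : H) :
    2 * ⟪f, u⟫ - ⟪u, u - r • P u⟫ ≤ ⟪f, v⟫ := by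
  have h1 := real_inner_clm_self_le hP (u - v)
  have h2 : 0 ≤ ⟪u - v, u - v⟫ := real_inner_self_nonneg
  have h3 : r * ⟪u - v, P (u - v)⟫ ≤ ⟪u - v, u - v⟫ := by nlinarith
  have e1 := hsymm v u
  have e2 := real_inner_comm u v
  have e3 := real_inner_comm u (P v)
  have e4 := real_inner_comm v (P v)
  subst hv
  simp only [map_sub, inner_sub_left, inner_sub_right, inner_smul_left, inner_smul_right,
    RCLike.conj_to_real] at h3 ⊢
  nlinarith

end Hilbert

/-- Comparison of summed autocovariances of two contractions on Hilbert spaces, given a domination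
of the Dirichlet form of the second by that of the first. -/
theorem tsum_inner_pow_comparison {H₁ H₂ : Type*}
    [NormedAddCommGroup H₁] [InnerProductSpace ℝ H₁] [CompleteSpace H₁]
    [NormedAddCommGroup H₂] [InnerProductSpace ℝ H₂] [CompleteSpace H₂]
    {P₁ : H₁ →L[ℝ] H₁} {P₂ : H₂ →L[ℝ] H₂} (hP₁ : ‖P₁‖ ≤ 1) (hP₂ : ‖P₂‖ ≤ 1)
    (hsymm : ∀ x y, ⟪P₂ x, y⟫ = ⟪x, P₂ y⟫) {h : H₁} {f : H₂} {C : ℝ}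
    (hcomp : ∀ u : H₁, ∃ v : H₂, C * ⟪h, u⟫ = ⟪f, v⟫ ∧ ⟪v, v⟫ ≤ C * ⟪u, u⟫ ∧
      ⟪v, v - P₂ v⟫ ≤ C * ⟪u, u - P₁ u⟫)
    (hs₁ : Summable fun k : ℕ => ⟪h, (P₁ ^ k) h⟫) (hs₂ : Summable fun k : ℕ => ⟪f, (P₂ ^ k) f⟫) :
    C * ∑' k : ℕ, ⟪h, (P₁ ^ k) h⟫ ≤ ∑' k : ℕ, ⟪f, (P₂ ^ k) f⟫ := by
  have t₁ := (Real.tendsto_tsum_powerSeries_nhdsWithin_lt hs₁.hasSum.tendsto_sum_nat).const_mul C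
  have t₂ := Real.tendsto_tsum_powerSeries_nhdsWithin_lt hs₂.hasSum.tendsto_sum_nat
  refine le_of_tendsto_of_tendsto t₁ t₂ ?_
  filter_upwards [Ioo_mem_nhdsLT (show (0 : ℝ) < 1 from one_pos)] with r hr
  obtain ⟨u, hu, hu'⟩ := exists_abel_resolvent hP₁ h hr.1.le hr.2
  obtain ⟨v, hv, hv'⟩ := exists_abel_resolvent hP₂ f hr.1.le hr.2
  rw [← hu', ← hv']
  obtain ⟨z, hz1, hz2, hz3⟩ := hcomp u
  have key := two_inner_sub_form_le hP₂ hsymm hr.1.le hr.2.le hv z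
  have e : ⟪h, u⟫ = ⟪u, u - r • P₁ u⟫ := by rw [hu, real_inner_comm]
  have e' : C * ⟪h, u⟫ = C * ⟪u, u - r • P₁ u⟫ := by rw [e]
  simp only [inner_sub_right, inner_smul_right] at *
  nlinarith [hr.1, hr.2, mul_le_mul_of_nonneg_left hz3 hr.1.le,
    mul_le_mul_of_nonneg_left hz2 (sub_nonneg.2 hr.2.le)]

theorem integral_comp_measurePreserving {X Z : Type*} [MeasurableSpace X] [MeasurableSpace Z]
    {μ : Measure X} {ρ : Measure Z} {p : X → Z} (hp : MeasurePreserving p μ ρ) {v : Z → ℝ}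
    (hv : AEStronglyMeasurable v ρ) : ∫ x, v (p x) ∂μ = ∫ z, v z ∂ρ := by
  obtain ⟨hm, rfl⟩ := hp
  exact (integral_map hm.aemeasurable hv).symm

section Reversible

variable {X : Type*} [MeasurableSpace X] {μ : Measure X} [IsProbabilityMeasure μ]
  {Q : Kernel X X} [IsMarkovKernel Q]

theorem measurePreserving_fst_compProd : MeasurePreserving Prod.fst (μ ⊗ₘ Q) μ :=
  ⟨measurable_fst, Measure.fst_compProd μ Q⟩

theorem measurePreserving_snd_compProd (h : (μ ⊗ₘ Q).map Prod.swap = μ ⊗ₘ Q) :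
    MeasurePreserving Prod.snd (μ ⊗ₘ Q) μ :=
  (measurePreserving_fst_compProd (μ := μ) (Q := Q)).comp ⟨measurable_swap, h⟩

/-- The `L²(μ)` operator of a Markov kernel `Q` reversible with respect to `μ`. -/
def transitionCLM (h : (μ ⊗ₘ Q).map Prod.swap = μ ⊗ₘ Q) : Lp ℝ 2 μ →L[ℝ] Lp ℝ 2 μ :=
  (ContinuousLinearMap.adjoint
    (Lp.compMeasurePreservingₗᵢ ℝ Prod.fst
      (measurePreserving_fst_compProd (μ := μ) (Q := Q))).toContinuousLinearMap).comp
    (Lp.compMeasurePreservingₗᵢ ℝ Prod.snd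
      (measurePreserving_snd_compProd h)).toContinuousLinearMap

variable (h : (μ ⊗ₘ Q).map Prod.swap = μ ⊗ₘ Q)

theorem inner_transitionCLM (u v : Lp ℝ 2 μ) :
    ⟪u, transitionCLM h v⟫ = ∫ z, u z.1 * v z.2 ∂(μ ⊗ₘ Q) := by
  rw [transitionCLM, ContinuousLinearMap.comp_apply, ContinuousLinearMap.adjoint_inner_right,
    L2.inner_def]
  refine integral_congr_ae ?_
  filter_upwards [Lp.coeFn_compMeasurePreserving u
      (measurePreserving_fst_compProd (μ := μ) (Q := Q)),
    Lp.coeFn_compMeasurePreserving v (measurePreserving_snd_compProd h)] with z h1 h2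
  refine Eq.trans (congrArg₂ (fun a b : ℝ => ⟪a, b⟫) h1 h2) ?_
  simp [mul_comm]

theorem transitionCLM_symm (u v : Lp ℝ 2 μ) :
    ⟪transitionCLM h u, v⟫ = ⟪u, transitionCLM h v⟫ := by
  rw [real_inner_comm, inner_transitionCLM, inner_transitionCLM]
  have := (⟨measurable_swap, h⟩ : MeasurePreserving Prod.swap (μ ⊗ₘ Q) (μ ⊗ₘ Q)).integral_comp
    MeasurableEquiv.prodComm.measurableEmbedding (fun z : X × X => u z.1 * v z.2)
  rw [← this]
  simp [mul_comm]

theorem norm_transitionCLM_le : ‖transitionCLM h‖ ≤ 1 := by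
  refine (ContinuousLinearMap.opNorm_comp_le _ _).trans ?_
  refine mul_le_one₀ ?_ (norm_nonneg _) (LinearIsometry.norm_toContinuousLinearMap_le _)
  rw [LinearIsometryEquiv.norm_map]
  exact LinearIsometry.norm_toContinuousLinearMap_le _

theorem inner_self_sub_transitionCLM (u : Lp ℝ 2 μ) :
    ⟪u, u - transitionCLM h u⟫ = 2⁻¹ * ∫ z, (u z.1 - u z.2) ^ 2 ∂(μ ⊗ₘ Q) := by
  have m1 := (Lp.memLp u).comp_measurePreserving
    (measurePreserving_fst_compProd (μ := μ) (Q := Q))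
  have m2 := (Lp.memLp u).comp_measurePreserving (measurePreserving_snd_compProd h)
  have i12 : Integrable (fun z : X × X => u z.1 * u z.2) (μ ⊗ₘ Q) := m1.integrable_mul m2
  have i1 : Integrable (fun z : X × X => u z.1 ^ 2) (μ ⊗ₘ Q) := m1.integrable_sq
  have i2 : Integrable (fun z : X × X => u z.2 ^ 2) (μ ⊗ₘ Q) := m2.integrable_sq
  have e0 : ⟪u, u⟫ = ∫ x, u x ^ 2 ∂μ := by
    rw [L2.inner_def]; simp [pow_two]
  have e1 : ∫ z, u z.1 ^ 2 ∂(μ ⊗ₘ Q) = ∫ x, u x ^ 2 ∂μ :=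
    integral_comp_measurePreserving measurePreserving_fst_compProd
      (Lp.memLp u).integrable_sq.1
  have e2 : ∫ z, u z.2 ^ 2 ∂(μ ⊗ₘ Q) = ∫ x, u x ^ 2 ∂μ :=
    integral_comp_measurePreserving (measurePreserving_snd_compProd h)
      (Lp.memLp u).integrable_sq.1
  rw [inner_sub_right, inner_transitionCLM, e0]
  have : ∀ z : X × X, (u z.1 - u z.2) ^ 2 = u z.1 ^ 2 + u z.2 ^ 2 - 2 * (u z.1 * u z.2) :=
    fun z => by ring
  simp_rw [this]
  rw [integral_sub (by exact i1.add i2) (i12.const_mul 2), integral_add i1 i2,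
    integral_const_mul, e1, e2]
  ring

theorem ae_integral_kernel_eq_transitionCLM {v : X → ℝ} {u : Lp ℝ 2 μ} (huv : v =ᵐ[μ] u) :
    ∀ᵐ x ∂μ, Integrable v (Q x) ∧ ∫ y, v y ∂(Q x) = transitionCLM h u x := by
  have m2 := (Lp.memLp u).comp_measurePreserving (measurePreserving_snd_compProd h)
  have hv2 : (fun z : X × X => v z.2) =ᵐ[μ ⊗ₘ Q] u ∘ Prod.snd :=
    (measurePreserving_snd_compProd h).quasiMeasurePreserving.ae_eq_comp huv
  have i2 : Integrable (fun z : X × X => v z.2) (μ ⊗ₘ Q) :=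
    (m2.integrable one_le_two).congr hv2.symm
  have h_integral : Integrable (fun x => ∫ y, v y ∂(Q x)) μ :=
    Integrable.integral_compProd (κ := Kernel.const Unit μ) (η := Kernel.prodMkLeft Unit Q) (a := ()) i2
  have hae := ((Measure.integrable_compProd_iff i2.1).1 i2).1
  have heq : (fun x => ∫ y, v y ∂(Q x)) =ᵐ[μ] transitionCLM h u := by
    refine h_integral.ae_eq_of_forall_setIntegral_eq _ _
      ((Lp.memLp (transitionCLM h u)).integrable one_le_two) fun s hs _ => ?_
    have a := L2.inner_indicatorConstLp_one (𝕜 := ℝ) hs (measure_ne_top μ s) (transitionCLM h u)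
    rw [← a, inner_transitionCLM]
    have b : ∫ z, (indicatorConstLp 2 hs (measure_ne_top μ s) (1 : ℝ)) z.1 * u z.2 ∂(μ ⊗ₘ Q)
        = ∫ z in s ×ˢ Set.univ, v z.2 ∂(μ ⊗ₘ Q) := by
      rw [← integral_indicator (hs.prod MeasurableSet.univ)]
      refine integral_congr_ae ?_
      filter_upwards [hv2, (measurePreserving_fst_compProd (μ := μ)
        (Q := Q)).quasiMeasurePreserving.ae_eq_comp
          (indicatorConstLp_coeFn (p := 2) (hs := hs) (hμs := measure_ne_top μ s)
            (c := (1 : ℝ)))] with z h1 h2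
      simp only [Function.comp] at h1 h2
      rw [h2]
      by_cases hz : z.1 ∈ s <;> simp [hz, h1]
    rw [b, Measure.setIntegral_compProd hs MeasurableSet.univ i2.integrableOn]
    simp
  filter_upwards [hae, heq] with x h1 h2 using ⟨h1, h2⟩

theorem ae_eq_iterate_transitionCLM {M : (X → ℝ) → X → ℝ}
    (hmeas : ∀ v, Measurable v → Measurable (M v))
    (hM : ∀ v x, Measurable v → Integrable v (Q x) → M v x = ∫ y, v y ∂(Q x))
    {v : X → ℝ} {u : Lp ℝ 2 μ} (hv : Measurable v) (huv : v =ᵐ[μ] u) (k : ℕ) :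
    M^[k] v =ᵐ[μ] (transitionCLM h ^ k) u := by
  have key : ∀ k : ℕ, Measurable (M^[k] v) ∧ M^[k] v =ᵐ[μ] (transitionCLM h ^ k) u := by
    intro k
    induction k with
    | zero => exact ⟨hv, huv⟩
    | succ k ih =>
      rw [Function.iterate_succ_apply', pow_succ']
      refine ⟨hmeas _ ih.1, ?_⟩
      filter_upwards [ae_integral_kernel_eq_transitionCLM h ih.2] with x hx
      rw [hM _ x ih.1 hx.1, hx.2]
      rfl
  exact (key k).2

end Reversible

section Comparison

variable {X : Type*} [MeasurableSpace X]

theorem integral_ofReal_smul_withDensity {μ : Measure X} {w : X → ℝ} (hw : Measurable w)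
    (hw0 : ∀ x, 0 ≤ w x) {C : ℝ} (hC : 0 ≤ C) (v : X → ℝ) :
    ∫ x, v x ∂(ENNReal.ofReal C • μ.withDensity fun x => ENNReal.ofReal (w x))
      = C * ∫ x, w x * v x ∂μ := by
  rw [integral_smul_measure, integral_withDensity_eq_integral_toReal_smul hw.ennreal_ofReal
    (ae_of_all _ fun _ => ENNReal.ofReal_lt_top)]
  simp [ENNReal.toReal_ofReal, hw0, hC]

/-- Two reversible chains, the target of the second having density `C * w` with respect to that of
the first, and off-diagonal flow dominated by `C` times that of the first. -/
theorem asymptoticVariance_comparison {μ₁ μ₂ : Measure X}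
    [IsProbabilityMeasure μ₁] [IsProbabilityMeasure μ₂] {Q₁ Q₂ : Kernel X X}
    [IsMarkovKernel Q₁] [IsMarkovKernel Q₂]
    (h₁ : (μ₁ ⊗ₘ Q₁).map Prod.swap = μ₁ ⊗ₘ Q₁) (h₂ : (μ₂ ⊗ₘ Q₂).map Prod.swap = μ₂ ⊗ₘ Q₂)
    {C : ℝ} (hC : 0 < C) {w : X → ℝ} (hw : Measurable w) (hw0 : ∀ x, 0 ≤ w x)
    (hw1 : ∀ x, w x ≤ 1)
    (hμ : μ₂ = ENNReal.ofReal C • μ₁.withDensity fun x => ENNReal.ofReal (w x))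
    (hdom : ∀ F : X × X → ℝ≥0∞, Measurable F → (∀ x, F (x, x) = 0) →
      ∫⁻ z, F z ∂(μ₂ ⊗ₘ Q₂) ≤ ENNReal.ofReal C * ∫⁻ z, F z ∂(μ₁ ⊗ₘ Q₁))
    {M₁ M₂ : (X → ℝ) → X → ℝ}
    (hmeas₁ : ∀ v, Measurable v → Measurable (M₁ v))
    (hM₁ : ∀ v x, Measurable v → Integrable v (Q₁ x) → M₁ v x = ∫ y, v y ∂(Q₁ x))
    (hmeas₂ : ∀ v, Measurable v → Measurable (M₂ v))
    (hM₂ : ∀ v x, Measurable v → Integrable v (Q₂ x) → M₂ v x = ∫ y, v y ∂(Q₂ x))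
    {f : X → ℝ} (hf : Measurable f) (hf2 : MemLp f 2 μ₂)
    (hs₁ : Summable fun k : ℕ =>
      |∫ x, (w x * f x) * M₁^[k + 1] (fun x => w x * f x) x ∂μ₁|)
    (hs₂ : Summable fun k : ℕ => |∫ x, f x * M₂^[k + 1] f x ∂μ₂|) :
    C ^ 2 * (∫ x, (w x * f x) ^ 2 ∂μ₁
        + 2 * ∑' k : ℕ, ∫ x, (w x * f x) * M₁^[k + 1] (fun x => w x * f x) x ∂μ₁)
      ≤ C * ((∫ x, f x ^ 2 ∂μ₂ + 2 * ∑' k : ℕ, ∫ x, f x * M₂^[k + 1] f x ∂μ₂)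
        + ∫ x, f x ^ 2 * (1 - w x) ∂μ₂) := by
  have h_integral : ∀ v : X → ℝ, ∫ x, v x ∂μ₂ = C * ∫ x, w x * v x ∂μ₁ := by
    subst hμ
    exact integral_ofReal_smul_withDensity hw hw0 hC.le
  have hdom' : μ₂ ≤ ENNReal.ofReal C • μ₁ := by
    rw [hμ]
    gcongr
    refine (withDensity_mono (ae_of_all _ fun x => ?_)).trans_eq withDensity_one
    simpa using hw1 x
  have hf2i := hf2.integrable_sq
  have hwf2i : Integrable (fun x => w x * f x ^ 2) μ₁ := by
    rw [hμ, integrable_smul_measure (by simpa using hC) ENNReal.ofReal_ne_top,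
      integrable_withDensity_iff_integrable_smul' hw.ennreal_ofReal
        (ae_of_all _ fun _ => ENNReal.ofReal_lt_top)] at hf2i
    simpa [ENNReal.toReal_ofReal, hw0] using hf2i
  have hg : Measurable fun x => w x * f x := hw.mul hf
  have hg2 : MemLp (fun x => w x * f x) 2 μ₁ := by
    refine (memLp_two_iff_integrable_sq hg.aestronglyMeasurable).2 ?_
    refine hwf2i.mono' (by fun_prop) (ae_of_all _ fun x => ?_)
    rw [Real.norm_of_nonneg (sq_nonneg _)]
    nlinarith [mul_nonneg (mul_nonneg (hw0 x) (sub_nonneg.2 (hw1 x))) (sq_nonneg (f x))]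
  have hcov₁ : ∀ k, ⟪hg2.toLp _, (transitionCLM h₁ ^ k) (hg2.toLp _)⟫
      = ∫ x, (w x * f x) * M₁^[k] (fun x => w x * f x) x ∂μ₁ := by
    intro k
    rw [L2.inner_def]
    refine integral_congr_ae ?_
    filter_upwards [hg2.coeFn_toLp, ae_eq_iterate_transitionCLM h₁ hmeas₁ hM₁ hg
      hg2.coeFn_toLp.symm k] with x e1 e2
    rw [e1, e2]
    simp [mul_comm]
  have hcov₂ : ∀ k, ⟪hf2.toLp _, (transitionCLM h₂ ^ k) (hf2.toLp _)⟫
      = ∫ x, f x * M₂^[k] f x ∂μ₂ := by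
    intro k
    rw [L2.inner_def]
    refine integral_congr_ae ?_
    filter_upwards [hf2.coeFn_toLp, ae_eq_iterate_transitionCLM h₂ hmeas₂ hM₂ hf
      hf2.coeFn_toLp.symm k] with x e1 e2
    rw [e1, e2]
    simp [mul_comm]
  have hs₁' : Summable fun k : ℕ => ∫ x, (w x * f x) * M₁^[k] (fun x => w x * f x) x ∂μ₁ :=
    (summable_nat_add_iff 1).1 hs₁.of_abs
  have hs₂' : Summable fun k : ℕ => ∫ x, f x * M₂^[k] f x ∂μ₂ :=
    (summable_nat_add_iff 1).1 hs₂.of_abs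
  have main := tsum_inner_pow_comparison (norm_transitionCLM_le h₁) (norm_transitionCLM_le h₂)
    (transitionCLM_symm h₂) (h := hg2.toLp _) (f := hf2.toLp _) (C := C) ?_
    (by simpa only [hcov₁] using hs₁') (by simpa only [hcov₂] using hs₂')
  · simp only [hcov₁, hcov₂] at main
    rw [hs₁'.tsum_eq_zero_add, hs₂'.tsum_eq_zero_add] at main
    have e : ∫ x, f x ^ 2 * (1 - w x) ∂μ₂ = ∫ x, f x ^ 2 ∂μ₂ - C * ∫ x, (w x * f x) ^ 2 ∂μ₁ := by
      have e1 : ∫ x, w x * f x ^ 2 ∂μ₂ = C * ∫ x, (w x * f x) ^ 2 ∂μ₁ := by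
        rw [h_integral]
        congr 2
        ext x
        ring
      rw [← e1, ← integral_sub hf2i]
      · congr 1
        ext x
        ring
      · refine hf2i.mono' (by fun_prop) (ae_of_all _ fun x => ?_)
        rw [Real.norm_of_nonneg (mul_nonneg (hw0 x) (sq_nonneg _))]
        exact mul_le_of_le_one_left (sq_nonneg _) (hw1 x)
    simp only [Function.iterate_zero, id, ← pow_two] at main
    rw [e]
    nlinarith [mul_le_mul_of_nonneg_left main hC.le]
  · intro u
    have hu1 := Lp.memLp u
    have hu2 : MemLp u 2 μ₂ := (hu1.smul_measure ENNReal.ofReal_ne_top).mono_measure hdom'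
    have hum : Measurable u := (Lp.stronglyMeasurable u).measurable
    refine ⟨hu2.toLp _, ?_, ?_, ?_⟩
    · have e1 : ⟪hf2.toLp f, hu2.toLp u⟫ = ∫ x, f x * u x ∂μ₂ := by
        rw [L2.inner_def]
        refine integral_congr_ae ?_
        filter_upwards [hf2.coeFn_toLp, hu2.coeFn_toLp] with x e1 e2
        rw [e1, e2]
        simp [mul_comm]
      have e2 : ⟪hg2.toLp _, u⟫ = ∫ x, w x * (f x * u x) ∂μ₁ := by
        rw [L2.inner_def]
        refine integral_congr_ae ?_
        filter_upwards [hg2.coeFn_toLp] with x e1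
        rw [e1]
        simp [mul_comm, mul_assoc]
      rw [e1, e2, h_integral]
    · have e1 : ⟪hu2.toLp u, hu2.toLp u⟫ = ∫ x, u x ^ 2 ∂μ₂ := by
        rw [L2.inner_def]
        refine integral_congr_ae ?_
        filter_upwards [hu2.coeFn_toLp] with x e1
        rw [e1]
        simp [pow_two]
      have e2 : ⟪u, u⟫ = ∫ x, u x ^ 2 ∂μ₁ := by
        rw [L2.inner_def]
        simp [pow_two]
      rw [e1, e2, h_integral]
      refine mul_le_mul_of_nonneg_left ?_ hC.le
      refine integral_mono_of_nonneg (ae_of_all _ fun x => mul_nonneg (hw0 x) (sq_nonneg _))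
        hu1.integrable_sq (ae_of_all _ fun x => mul_le_of_le_one_left (sq_nonneg _) (hw1 x))
    · rw [inner_self_sub_transitionCLM, inner_self_sub_transitionCLM]
      have e1 : ∫ z, ((hu2.toLp u) z.1 - (hu2.toLp u) z.2) ^ 2 ∂(μ₂ ⊗ₘ Q₂)
          = ∫ z, (u z.1 - u z.2) ^ 2 ∂(μ₂ ⊗ₘ Q₂) := by
        refine integral_congr_ae ?_
        filter_upwards [(measurePreserving_fst_compProd (μ := μ₂)
            (Q := Q₂)).quasiMeasurePreserving.ae_eq_comp hu2.coeFn_toLp,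
          (measurePreserving_snd_compProd h₂).quasiMeasurePreserving.ae_eq_comp
            hu2.coeFn_toLp] with z e1 e2
        simp only [Function.comp] at e1 e2
        rw [e1, e2]
      have hi : Integrable (fun z : X × X => (u z.1 - u z.2) ^ 2) (μ₁ ⊗ₘ Q₁) :=
        ((hu1.comp_measurePreserving (measurePreserving_fst_compProd (μ := μ₁) (Q := Q₁))).sub
          (hu1.comp_measurePreserving (measurePreserving_snd_compProd h₁))).integrable_sq
      have hF : Measurable fun z : X × X => (u z.1 - u z.2) ^ 2 := by fun_prop
      have e2 : ∫ z, (u z.1 - u z.2) ^ 2 ∂(μ₂ ⊗ₘ Q₂)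
          ≤ C * ∫ z, (u z.1 - u z.2) ^ 2 ∂(μ₁ ⊗ₘ Q₁) := by
        rw [integral_eq_lintegral_of_nonneg_ae (ae_of_all _ fun _ => sq_nonneg _)
            hF.aestronglyMeasurable,
          integral_eq_lintegral_of_nonneg_ae (ae_of_all _ fun _ => sq_nonneg _)
            hF.aestronglyMeasurable, ← ENNReal.toReal_ofReal hC.le, ← ENNReal.toReal_mul]
        refine ENNReal.toReal_mono (ENNReal.mul_ne_top ENNReal.ofReal_ne_top ?_)
          (hdom _ hF.ennreal_ofReal (by simp))
        exact hi.lintegral_lt_top.ne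
      rw [e1]
      linarith

end Comparison

section Rejection

variable {X : Type*} [MeasurableSpace X]

/-- The kernel moving from `x` according to the sub-probability density `s x` with respect to `ρ`
and staying at `x` with the remaining probability. -/
def rejectionKernel (ρ : Measure X) [SFinite ρ] (s : X → X → ℝ≥0∞) : Kernel X X :=
  (Kernel.const X ρ).withDensity s + Kernel.id.withDensity fun x _ => 1 - ∫⁻ y, s x y ∂ρ

variable {ρ : Measure X} [SFinite ρ] {s : X → X → ℝ≥0∞}

theorem rejectionKernel_apply (hs : Measurable (Function.uncurry s)) (x : X) :
    rejectionKernel ρ s x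
      = ρ.withDensity (s x) + (1 - ∫⁻ y, s x y ∂ρ) • Measure.dirac x := by
  have hm : Measurable fun x => 1 - ∫⁻ y, s x y ∂ρ := hs.lintegral_prod_right'.const_sub 1
  rw [rejectionKernel, add_apply, Kernel.withDensity_apply _ hs,
    Kernel.withDensity_apply _ (by exact hm.comp measurable_fst), Kernel.const_apply,
    Kernel.id_apply, withDensity_const]

theorem lintegral_rejectionKernel (hs : Measurable (Function.uncurry s)) (x : X) {F : X → ℝ≥0∞}
    (hF : Measurable F) :
    ∫⁻ y, F y ∂(rejectionKernel ρ s x)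
      = ∫⁻ y, s x y * F y ∂ρ + (1 - ∫⁻ y, s x y ∂ρ) * F x := by
  rw [rejectionKernel_apply hs, lintegral_add_measure, lintegral_smul_measure,
    lintegral_dirac' _ hF, lintegral_withDensity_eq_lintegral_mul _ hs.of_uncurry_left hF]
  rfl

theorem isMarkovKernel_rejectionKernel (hs : Measurable (Function.uncurry s))
    (hs1 : ∀ x, ∫⁻ y, s x y ∂ρ ≤ 1) : IsMarkovKernel (rejectionKernel ρ s) := by
  refine ⟨fun x => ⟨?_⟩⟩
  rw [← lintegral_one, lintegral_rejectionKernel hs x measurable_const]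
  simpa using add_tsub_cancel_of_le (hs1 x)

theorem integral_rejectionKernel (hs : Measurable (Function.uncurry s))
    (hst : ∀ x y, s x y < ∞) {x : X} {v : X → ℝ} (hv : Measurable v)
    (hi : Integrable v (rejectionKernel ρ s x)) :
    Integrable (fun y => (s x y).toReal * v y) ρ ∧
    ∫ y, v y ∂(rejectionKernel ρ s x)
      = ∫ y, (s x y).toReal * v y ∂ρ + (1 - ∫⁻ y, s x y ∂ρ).toReal * v x := by
  rw [rejectionKernel_apply hs] at hi ⊢
  have hi1 := hi.left_of_add_measure
  have hi2 := hi.right_of_add_measure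
  rw [integral_add_measure hi1 hi2, integral_smul_measure,
    integral_dirac' _ _ hv.stronglyMeasurable,
    integral_withDensity_eq_integral_toReal_smul hs.of_uncurry_left (ae_of_all _ (hst x))]
  rw [integrable_withDensity_iff_integrable_smul' hs.of_uncurry_left (ae_of_all _ (hst x))] at hi1
  exact ⟨hi1, rfl⟩

theorem lintegral_smul_withDensity_compProd_rejectionKernel (hs : Measurable (Function.uncurry s))
    (hs1 : ∀ x, ∫⁻ y, s x y ∂ρ ≤ 1) {D : X → ℝ≥0∞} (hD : Measurable D) (a : ℝ≥0∞)
    {F : X × X → ℝ≥0∞} (hF : Measurable F) [SFinite (a • ρ.withDensity D)] :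
    ∫⁻ z, F z ∂((a • ρ.withDensity D) ⊗ₘ rejectionKernel ρ s)
      = a * (∫⁻ x, ∫⁻ y, D x * s x y * F (x, y) ∂ρ ∂ρ
        + ∫⁻ x, D x * ((1 - ∫⁻ y, s x y ∂ρ) * F (x, x)) ∂ρ) := by
  have := isMarkovKernel_rejectionKernel hs hs1
  have hm : Measurable fun x => 1 - ∫⁻ y, s x y ∂ρ := hs.lintegral_prod_right'.const_sub 1
  have hs' : Measurable fun z : X × X => s z.1 z.2 := hs
  have hm2 : Measurable fun x => ∫⁻ y, s x y * F (x, y) ∂ρ :=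
    (hs'.mul hF).lintegral_prod_right'
  have hFd : Measurable fun x => F (x, x) := by fun_prop
  rw [Measure.lintegral_compProd hF, lintegral_smul_measure]
  congr 1
  have hQ : ∀ x, ∫⁻ y, F (x, y) ∂(rejectionKernel ρ s x)
      = ∫⁻ y, s x y * F (x, y) ∂ρ + (1 - ∫⁻ y, s x y ∂ρ) * F (x, x) :=
    fun x => lintegral_rejectionKernel hs x (F := fun y => F (x, y))
      (hF.comp measurable_prodMk_left)
  simp_rw [hQ]
  rw [lintegral_withDensity_eq_lintegral_mul _ hD (by exact hm2.add (hm.mul hFd))]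
  simp only [Pi.mul_apply, mul_add]
  rw [lintegral_add_left (by exact hD.mul hm2)]
  congr 1
  refine lintegral_congr fun x => ?_
  rw [← lintegral_const_mul _ (by
    exact (hs.of_uncurry_left (x := x)).mul (hF.comp measurable_prodMk_left))]
  simp only [mul_assoc]

theorem map_swap_compProd_rejectionKernel (hs : Measurable (Function.uncurry s))
    (hs1 : ∀ x, ∫⁻ y, s x y ∂ρ ≤ 1) {D : X → ℝ≥0∞} (hD : Measurable D)
    (hsymm : ∀ x y, D x * s x y = D y * s y x) (a : ℝ≥0∞) [SFinite (a • ρ.withDensity D)] :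
    ((a • ρ.withDensity D) ⊗ₘ rejectionKernel ρ s).map Prod.swap
      = (a • ρ.withDensity D) ⊗ₘ rejectionKernel ρ s := by
  refine Measure.ext_of_lintegral _ fun F hF => ?_
  have hs' : Measurable fun z : X × X => s z.1 z.2 := hs
  rw [lintegral_map hF measurable_swap,
    lintegral_smul_withDensity_compProd_rejectionKernel hs hs1 hD a
      (F := fun z => F z.swap) (hF.comp measurable_swap),
    lintegral_smul_withDensity_compProd_rejectionKernel hs hs1 hD a hF]
  congr 2
  rw [lintegral_lintegral_swap (by
    refine Measurable.aemeasurable ?_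
    simp only [Function.uncurry_def]
    fun_prop)]
  simp only [Prod.swap_prod_mk, hsymm]

end Rejection

section Acceptance

variable {T Y : Type*} {pr : T → ℝ} {d : Y → ℝ} {φ : ℝ → ℝ} {q : T → T → ℝ} {t : ℝ}

/-- Density of an accepted ABC-MCMC(t) move with respect to `ν ⊗ₘ g`. -/
def acceptedDensity (pr : T → ℝ) (q : T → T → ℝ) (φ : ℝ → ℝ) (d : Y → ℝ) (t : ℝ)
    (x y : T × Y) : ℝ≥0∞ :=
  ENNReal.ofReal (q x.1 y.1 * accept pr q φ d t x y)

theorem accept_nonneg (hpr : ∀ θ, 0 ≤ pr θ) (hq : ∀ θ ϑ, 0 ≤ q θ ϑ) (hK : ∀ y, 0 ≤ K φ d t y)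
    (x y : T × Y) : 0 ≤ accept pr q φ d t x y :=
  le_min zero_le_one (div_nonneg (mul_nonneg (mul_nonneg (hpr _) (hq _ _)) (hK _))
    (mul_nonneg (mul_nonneg (hpr _) (hq _ _)) (hK _)))

theorem mul_acceptedDensity (hpr : ∀ θ, 0 ≤ pr θ) (hq : ∀ θ ϑ, 0 ≤ q θ ϑ)
    (hK : ∀ y, 0 ≤ K φ d t y) (x y : T × Y) :
    ENNReal.ofReal (pr x.1 * K φ d t x.2) * acceptedDensity pr q φ d t x y
      = ENNReal.ofReal (min (pr x.1 * q x.1 y.1 * K φ d t x.2)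
          (pr y.1 * q y.1 x.1 * K φ d t y.2)) := by
  rw [acceptedDensity, ← ENNReal.ofReal_mul (mul_nonneg (hpr _) (hK _))]
  congr 1
  have h1 : 0 ≤ pr x.1 * q x.1 y.1 * K φ d t x.2 :=
    mul_nonneg (mul_nonneg (hpr _) (hq _ _)) (hK _)
  have h2 : 0 ≤ pr y.1 * q y.1 x.1 * K φ d t y.2 :=
    mul_nonneg (mul_nonneg (hpr _) (hq _ _)) (hK _)
  have e : pr x.1 * K φ d t x.2 * (q x.1 y.1 * accept pr q φ d t x y)
      = (pr x.1 * q x.1 y.1 * K φ d t x.2) * accept pr q φ d t x y := by ring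
  rw [e, accept]
  rcases h1.eq_or_lt with h | h
  · rw [← h, zero_mul, min_eq_left h2]
  · rw [mul_min_of_nonneg _ _ h1, mul_one, mul_div_cancel₀ _ h.ne']

end Acceptance

section MetropolisHastings

variable {T Y : Type*} [MeasurableSpace T] [MeasurableSpace Y]
  {ν : Measure T} [SigmaFinite ν] {pr : T → ℝ} {g : Kernel T Y} [IsMarkovKernel g]
  {d : Y → ℝ} {φ : ℝ → ℝ} {q : T → T → ℝ} {t : ℝ}

theorem measurable_accept (hpr : Measurable pr)
    (hq : Measurable fun p : T × T => q p.1 p.2) (hK : Measurable (K φ d t)) :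
    Measurable fun z : (T × Y) × (T × Y) => accept pr q φ d t z.1 z.2 := by
  have h1 : Measurable fun z : (T × Y) × (T × Y) => q z.1.1 z.2.1 :=
    hq.comp (by fun_prop : Measurable fun z : (T × Y) × (T × Y) => (z.1.1, z.2.1))
  have h2 : Measurable fun z : (T × Y) × (T × Y) => q z.2.1 z.1.1 :=
    hq.comp (by fun_prop : Measurable fun z : (T × Y) × (T × Y) => (z.2.1, z.1.1))
  unfold accept
  fun_prop

theorem measurable_acceptedDensity (hpr : Measurable pr)
    (hq : Measurable fun p : T × T => q p.1 p.2) (hK : Measurable (K φ d t)) :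
    Measurable (Function.uncurry (acceptedDensity pr q φ d t)) := by
  have h1 : Measurable fun z : (T × Y) × (T × Y) => q z.1.1 z.2.1 :=
    hq.comp (by fun_prop : Measurable fun z : (T × Y) × (T × Y) => (z.1.1, z.2.1))
  exact (h1.mul (measurable_accept hpr hq hK)).ennreal_ofReal

theorem lintegral_acceptedDensity_le_one (hq : Measurable fun p : T × T => q p.1 p.2)
    (hq0 : ∀ θ ϑ, 0 ≤ q θ ϑ) (hq1 : ∀ θ, ∫ ϑ, q θ ϑ ∂ν = 1) (x : T × Y) :
    ∫⁻ y, acceptedDensity pr q φ d t x y ∂(ν ⊗ₘ g) ≤ 1 := by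
  have hqx : Measurable (q x.1) := hq.comp measurable_prodMk_left
  have hqi : Integrable (q x.1) ν := by
    by_contra h
    simpa [integral_undef h] using hq1 x.1
  calc ∫⁻ y, acceptedDensity pr q φ d t x y ∂(ν ⊗ₘ g)
      ≤ ∫⁻ y, ENNReal.ofReal (q x.1 y.1) ∂(ν ⊗ₘ g) := by
        refine lintegral_mono fun y => ENNReal.ofReal_le_ofReal ?_
        exact mul_le_of_le_one_right (hq0 _ _) (min_le_left _ _)
    _ = ∫⁻ ϑ, ENNReal.ofReal (q x.1 ϑ) ∂ν := by
        rw [Measure.lintegral_compProd (by fun_prop)]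
        simp
    _ = 1 := by
        rw [← ofReal_integral_eq_lintegral_ofReal hqi (ae_of_all _ (hq0 _)), hq1]
        simp

theorem measurable_MHop (hpr : Measurable pr) (hq : Measurable fun p : T × T => q p.1 p.2)
    (hK : Measurable (K φ d t)) {v : T × Y → ℝ} (hv : Measurable v) :
    Measurable (MHop ν g pr q φ d t v) := by
  have key : ∀ v : T × Y → ℝ, Measurable v → Measurable fun p : T × Y =>
      ∫ ϑ, q p.1 ϑ * ∫ y', accept pr q φ d t p (ϑ, y') * v (ϑ, y') ∂(g ϑ) ∂ν := by
    intro v hv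
    have ha : Measurable fun z : ((T × Y) × T) × Y =>
        accept pr q φ d t z.1.1 (z.1.2, z.2) * v (z.1.2, z.2) :=
      ((measurable_accept hpr hq hK).comp (by fun_prop :
        Measurable fun z : ((T × Y) × T) × Y => (z.1.1, (z.1.2, z.2)))).mul (by fun_prop)
    have hin : StronglyMeasurable fun z : (T × Y) × T =>
        ∫ y', accept pr q φ d t z.1 (z.2, y') * v (z.2, y') ∂(g z.2) :=
      StronglyMeasurable.integral_kernel_prod_right (κ := g.comap Prod.snd measurable_snd)
        (f := fun (z : (T × Y) × T) y' => accept pr q φ d t z.1 (z.2, y') * v (z.2, y'))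
        ha.stronglyMeasurable
    have hq' : Measurable fun z : (T × Y) × T => q z.1.1 z.2 :=
      hq.comp (by fun_prop : Measurable fun z : (T × Y) × T => (z.1.1, z.2))
    exact (StronglyMeasurable.integral_prod_right
      (f := fun (p : T × Y) ϑ => q p.1 ϑ *
        ∫ y', accept pr q φ d t p (ϑ, y') * v (ϑ, y') ∂(g ϑ))
      (hq'.stronglyMeasurable.mul hin)).measurable
  have h1 := key (fun _ => 1) measurable_const
  simp only [mul_one] at h1
  exact (key v hv).add ((h1.const_sub 1).mul hv)

theorem MHop_eq_integral_rejectionKernel (hpr : Measurable pr) (hpr0 : ∀ θ, 0 ≤ pr θ)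
    (hq : Measurable fun p : T × T => q p.1 p.2) (hq0 : ∀ θ ϑ, 0 ≤ q θ ϑ)
    (hq1 : ∀ θ, ∫ ϑ, q θ ϑ ∂ν = 1) (hK : Measurable (K φ d t)) (hK0 : ∀ y, 0 ≤ K φ d t y)
    {v : T × Y → ℝ} {x : T × Y} (hv : Measurable v)
    (hi : Integrable v (rejectionKernel (ν ⊗ₘ g) (acceptedDensity pr q φ d t) x)) :
    MHop ν g pr q φ d t v x
      = ∫ y, v y ∂(rejectionKernel (ν ⊗ₘ g) (acceptedDensity pr q φ d t) x) := by
  have hs := measurable_acceptedDensity hpr hq hK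
  have hs0 : ∀ y, (acceptedDensity pr q φ d t x y).toReal = q x.1 y.1 * accept pr q φ d t x y :=
    fun y => ENNReal.toReal_ofReal (mul_nonneg (hq0 _ _) (accept_nonneg hpr0 hq0 hK0 _ _))
  have hle := lintegral_acceptedDensity_le_one (ν := ν) (g := g) (pr := pr) (φ := φ) (d := d)
    (t := t) hq hq0 hq1 x
  obtain ⟨h1, h2⟩ := integral_rejectionKernel hs (fun _ _ => ENNReal.ofReal_lt_top) hv hi
  have hmi : Integrable (fun y => (acceptedDensity pr q φ d t x y).toReal) (ν ⊗ₘ g) :=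
    integrable_toReal_of_lintegral_ne_top hs.of_uncurry_left.aemeasurable
      (hle.trans_lt ENNReal.one_lt_top).ne
  have hm : (1 - ∫⁻ y, acceptedDensity pr q φ d t x y ∂(ν ⊗ₘ g)).toReal
      = 1 - ∫ ϑ, q x.1 ϑ * ∫ y', accept pr q φ d t x (ϑ, y') ∂(g ϑ) ∂ν := by
    rw [ENNReal.toReal_sub_of_le hle ENNReal.one_ne_top, ENNReal.toReal_one,
      ← integral_toReal hs.of_uncurry_left.aemeasurable
        (ae_of_all _ fun _ => ENNReal.ofReal_lt_top), Measure.integral_compProd hmi]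
    simp only [hs0, integral_const_mul]
  rw [h2, hm, Measure.integral_compProd h1]
  simp only [hs0, mul_assoc, integral_const_mul]
  rfl

end MetropolisHastings

section Weights

variable {T Y : Type*} [MeasurableSpace T] [MeasurableSpace Y]
  {ν : Measure T} {pr : T → ℝ} {g : Kernel T Y} {d : Y → ℝ} {φ : ℝ → ℝ} {t : ℝ}

theorem measurable_K (hφ : Measurable φ) (hd : Measurable d) : Measurable (K φ d t) :=
  hφ.comp (hd.div_const t)

theorem measurable_w (hφ : Measurable φ) (hd : Measurable d) {δ ε : ℝ} :
    Measurable (w φ d δ ε) :=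
  Measurable.ite (measurableSet_lt measurable_const (measurable_K hφ hd))
    ((measurable_K hφ hd).div (measurable_K hφ hd)) measurable_const

theorem piJoint_eq_smul_withDensity (hpr : Measurable pr) (hpr0 : ∀ θ, 0 ≤ pr θ) {δ ε : ℝ}
    (hφ : Measurable φ) (hd : Measurable d) (hδ0 : ∀ y, 0 ≤ K φ d δ y)
    (hw : ∀ y, K φ d δ y * w φ d δ ε y = K φ d ε y)
    (hcδ : 0 < c ν pr g φ d δ) (hcε : 0 < c ν pr g φ d ε) :
    piJoint ν pr g φ d ε = ENNReal.ofReal (c ν pr g φ d δ / c ν pr g φ d ε) •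
      (piJoint ν pr g φ d δ).withDensity fun p => ENNReal.ofReal (w φ d δ ε p.2) := by
  have hK : Measurable (K φ d δ) := measurable_K hφ hd
  have hwm : Measurable (w φ d δ ε) := measurable_w hφ hd
  rw [piJoint, piJoint, withDensity_smul_measure, ← withDensity_mul _ (by fun_prop) (by fun_prop),
    smul_smul, ENNReal.ofReal_div_of_pos hcε, div_eq_mul_inv, mul_right_comm,
    ENNReal.mul_inv_cancel (by simpa using hcδ) ENNReal.ofReal_ne_top, one_mul]
  congr 2
  ext p
  rw [Pi.mul_apply, ← ENNReal.ofReal_mul (mul_nonneg (hpr0 _) (hδ0 _)), mul_assoc, hw]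

end Weights

section ABC

variable {T Y : Type*} [MeasurableSpace T] [MeasurableSpace Y]
  {ν : Measure T} [SigmaFinite ν] {pr : T → ℝ} {g : Kernel T Y} [IsMarkovKernel g]
  {d : Y → ℝ} {φ : ℝ → ℝ} {t : ℝ}

theorem lintegral_fst_piJoint (hpr : Measurable pr) (hpr0 : ∀ θ, 0 ≤ pr θ)
    (hK : Measurable (K φ d t)) (hK0 : ∀ y, 0 ≤ K φ d t y) (hK1 : ∀ y, K φ d t y ≤ 1)
    {F : T → ℝ≥0∞} (hF : Measurable F) :
    ∫⁻ p, F p.1 ∂(piJoint ν pr g φ d t) = ∫⁻ θ, F θ ∂(piPost ν pr g φ d t) := by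
  have hKi : ∀ θ, Integrable (K φ d t) (g θ) := fun θ =>
    (integrable_const (1 : ℝ)).mono' hK.aestronglyMeasurable
      (ae_of_all _ fun y => by simpa [abs_of_nonneg (hK0 y)] using hK1 y)
  have hL : Measurable (L g φ d t) :=
    (StronglyMeasurable.integral_kernel_prod_right (κ := g) (f := fun (_ : T) y => K φ d t y)
      (by fun_prop : Measurable fun z : T × Y => K φ d t z.2).stronglyMeasurable).measurable
  have hd : Measurable fun p : T × Y => ENNReal.ofReal (pr p.1 * K φ d t p.2) := by fun_prop
  rw [piJoint, piPost, lintegral_smul_measure, lintegral_smul_measure,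
    lintegral_withDensity_eq_lintegral_mul _ hd (by fun_prop),
    lintegral_withDensity_eq_lintegral_mul _ (by fun_prop) hF,
    Measure.lintegral_compProd (by fun_prop)]
  congr 1
  refine lintegral_congr fun θ => ?_
  simp only [Pi.mul_apply]
  rw [lintegral_mul_const _ (by fun_prop)]
  congr 1
  simp_rw [ENNReal.ofReal_mul (hpr0 θ)]
  rw [lintegral_const_mul _ (by fun_prop), L,
    ofReal_integral_eq_lintegral_ofReal (hKi θ) (ae_of_all _ hK0)]

theorem isProbabilityMeasure_piJoint (hpr : Measurable pr) (hpr0 : ∀ θ, 0 ≤ pr θ)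
    (hK : Measurable (K φ d t)) (hK0 : ∀ y, 0 ≤ K φ d t y) (hK1 : ∀ y, K φ d t y ≤ 1)
    (hc : 0 < c ν pr g φ d t) : IsProbabilityMeasure (piJoint ν pr g φ d t) := by
  refine ⟨?_⟩
  have hci : Integrable (fun θ => pr θ * L g φ d t θ) ν := by
    by_contra h
    rw [c, integral_undef h] at hc
    exact hc.false
  rw [← lintegral_one, lintegral_fst_piJoint hpr hpr0 hK hK0 hK1 (F := fun _ => 1)
    measurable_const, lintegral_one, piPost, Measure.smul_apply, withDensity_apply _ .univ,
    Measure.restrict_univ, ← ofReal_integral_eq_lintegral_ofReal hci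
      (ae_of_all _ fun θ => mul_nonneg (hpr0 θ) (integral_nonneg hK0))]
  exact ENNReal.inv_mul_cancel (by simpa using hc) ENNReal.ofReal_ne_top

end ABC

end ABC0

open ABC0

/-- Theorem 3 of the paper: Peskun-type bound for the post-corrected
asymptotic variance. -/
theorem stmt6 {T Y : Type*} [MeasurableSpace T] [MeasurableSpace Y]
    (ν : Measure T) [SigmaFinite ν]
    (pr : T → ℝ) (hpr_meas : Measurable pr) (hpr_nonneg : ∀ θ, 0 ≤ pr θ)
    (hpr_prob : ∫ θ, pr θ ∂ν = 1)
    (g : Kernel T Y) [IsMarkovKernel g]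
    (d : Y → ℝ) (hd_meas : Measurable d) (hd_nonneg : ∀ y, 0 ≤ d y)
    (φ : ℝ → ℝ) (hφ_meas : Measurable φ)
    (hφ01 : ∀ t, 0 ≤ t → 0 ≤ φ t ∧ φ t ≤ 1)
    (hφ_anti : ∀ s t, 0 ≤ s → s ≤ t → φ t ≤ φ s)
    (q : T → T → ℝ) (hq_meas : Measurable (fun p : T × T => q p.1 p.2))
    (hq_nonneg : ∀ θ ϑ, 0 ≤ q θ ϑ) (hq_prob : ∀ θ, ∫ ϑ, q θ ϑ ∂ν = 1)
    (ε δ : ℝ) (hε : 0 < ε) (hεδ : ε ≤ δ)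
    (hcδ : 0 < c ν pr g φ d δ) (hcε : 0 < c ν pr g φ d ε)
    (f : T → ℝ) (hf_meas : Measurable f)
    (hf2 : ∫⁻ θ, ENNReal.ofReal ((f θ) ^ 2) ∂(piPost ν pr g φ d ε) < ⊤)
    -- absolute convergence of the autocovariance series defining `σ²_{δ,ε}(f)`
    (hsumδ : Summable (fun k : ℕ =>
      |∫ p, (w φ d δ ε p.2 * (f p.1 - ∫ θ, f θ ∂(piPost ν pr g φ d ε))) *
          ((MHop ν g pr q φ d δ)^[k + 1]
            (fun p' => w φ d δ ε p'.2 * (f p'.1 - ∫ θ, f θ ∂(piPost ν pr g φ d ε)))) p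
          ∂(piJoint ν pr g φ d δ)|))
    -- absolute convergence of the autocovariance series defining `σ²_ε(f)`
    (hsumε : Summable (fun k : ℕ =>
      |∫ p, (f p.1 - ∫ θ, f θ ∂(piPost ν pr g φ d ε)) *
          ((MHop ν g pr q φ d ε)^[k + 1]
            (fun p' => f p'.1 - ∫ θ, f θ ∂(piPost ν pr g φ d ε))) p
          ∂(piJoint ν pr g φ d ε)|)) :
    (c ν pr g φ d δ / c ν pr g φ d ε) ^ 2 *
        ((∫ p, (w φ d δ ε p.2 * (f p.1 - ∫ θ, f θ ∂(piPost ν pr g φ d ε))) ^ 2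
            ∂(piJoint ν pr g φ d δ))
          + 2 * ∑' k : ℕ,
              ∫ p, (w φ d δ ε p.2 * (f p.1 - ∫ θ, f θ ∂(piPost ν pr g φ d ε))) *
                ((MHop ν g pr q φ d δ)^[k + 1]
                  (fun p' => w φ d δ ε p'.2 *
                    (f p'.1 - ∫ θ, f θ ∂(piPost ν pr g φ d ε)))) p
                ∂(piJoint ν pr g φ d δ))
      ≤ (c ν pr g φ d δ / c ν pr g φ d ε) *
          (((∫ p, (f p.1 - ∫ θ, f θ ∂(piPost ν pr g φ d ε)) ^ 2
              ∂(piJoint ν pr g φ d ε))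
            + 2 * ∑' k : ℕ,
                ∫ p, (f p.1 - ∫ θ, f θ ∂(piPost ν pr g φ d ε)) *
                  ((MHop ν g pr q φ d ε)^[k + 1]
                    (fun p' => f p'.1 - ∫ θ, f θ ∂(piPost ν pr g φ d ε))) p
                  ∂(piJoint ν pr g φ d ε))
            + ∫ p, (f p.1 - ∫ θ, f θ ∂(piPost ν pr g φ d ε)) ^ 2 *
                (1 - w φ d δ ε p.2) ∂(piJoint ν pr g φ d ε)) := by
  have hK0 : ∀ t, 0 < t → ∀ y, 0 ≤ K φ d t y := fun t ht y =>
    (hφ01 _ (div_nonneg (hd_nonneg y) ht.le)).1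
  have hK1 : ∀ t, 0 < t → ∀ y, K φ d t y ≤ 1 := fun t ht y =>
    (hφ01 _ (div_nonneg (hd_nonneg y) ht.le)).2
  have hδ : 0 < δ := hε.trans_le hεδ
  have hK_le : ∀ y, K φ d ε y ≤ K φ d δ y := fun y =>
    hφ_anti _ _ (div_nonneg (hd_nonneg y) hδ.le)
      (div_le_div_of_nonneg_left (hd_nonneg y) hε hεδ)
  have hK : ∀ t, Measurable (K φ d t) := fun t => measurable_K hφ_meas hd_meas
  have hw0 : ∀ y, 0 ≤ w φ d δ ε y := fun y => by
    unfold w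
    split_ifs
    · exact div_nonneg (hK0 ε hε y) (hK0 δ hδ y)
    · exact le_rfl
  have hw1 : ∀ y, w φ d δ ε y ≤ 1 := fun y => by
    unfold w
    split_ifs with h
    · exact (div_le_one h).2 (hK_le y)
    · exact zero_le_one
  have hKw : ∀ y, K φ d δ y * w φ d δ ε y = K φ d ε y := fun y => by
    unfold w
    split_ifs with h
    · exact mul_div_cancel₀ _ h.ne'
    · rw [mul_zero]
      exact le_antisymm (hK0 ε hε y) ((hK_le y).trans (not_lt.1 h))
  set m := ∫ θ, f θ ∂(piPost ν pr g φ d ε)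
  have hprobδ := isProbabilityMeasure_piJoint hpr_meas hpr_nonneg (hK δ) (hK0 δ hδ) (hK1 δ hδ) hcδ
  have hprobε := isProbabilityMeasure_piJoint hpr_meas hpr_nonneg (hK ε) (hK0 ε hε) (hK1 ε hε) hcε
  have hs : ∀ t, Measurable (Function.uncurry (acceptedDensity pr q φ d t)) := fun t =>
    measurable_acceptedDensity hpr_meas hq_meas (hK t)
  have hs1 : ∀ t x, ∫⁻ y, acceptedDensity pr q φ d t x y ∂(ν ⊗ₘ g) ≤ 1 := fun t =>
    lintegral_acceptedDensity_le_one hq_meas hq_nonneg hq_prob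
  have hmarkov : ∀ t, IsMarkovKernel (rejectionKernel (ν ⊗ₘ g) (acceptedDensity pr q φ d t)) :=
    fun t => isMarkovKernel_rejectionKernel (hs t) (hs1 t)
  have hD : ∀ t, Measurable fun p : T × Y => ENNReal.ofReal (pr p.1 * K φ d t p.2) := fun t => by
    have := hK t
    fun_prop
  have hrev : ∀ t, 0 < t → IsProbabilityMeasure (piJoint ν pr g φ d t) →
      (piJoint ν pr g φ d t ⊗ₘ rejectionKernel (ν ⊗ₘ g) (acceptedDensity pr q φ d t)).map
        Prod.swap
      = piJoint ν pr g φ d t ⊗ₘ rejectionKernel (ν ⊗ₘ g) (acceptedDensity pr q φ d t) := by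
    intro t ht hp
    unfold piJoint at hp ⊢
    refine map_swap_compProd_rejectionKernel (hs t) (hs1 t) (hD t) (fun x y => ?_) _
    rw [mul_acceptedDensity hpr_nonneg hq_nonneg (hK0 t ht),
      mul_acceptedDensity hpr_nonneg hq_nonneg (hK0 t ht), min_comm]
  have hMHmeas : ∀ t v, Measurable v → Measurable (MHop ν g pr q φ d t v) := fun t v hv =>
    measurable_MHop hpr_meas hq_meas (hK t) hv
  have hf1 : Measurable fun p : T × Y => f p.1 := hf_meas.comp measurable_fst
  have hfm : Measurable fun p : T × Y => f p.1 - m := hf1.sub_const m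
  have hfL2 : MemLp (fun p : T × Y => f p.1 - m) 2 (piJoint ν pr g φ d ε) := by
    refine MemLp.sub ?_ (memLp_const m)
    refine (memLp_two_iff_integrable_sq hf1.aestronglyMeasurable).2
      ⟨(hf1.pow_const 2).aestronglyMeasurable, ?_⟩
    rw [hasFiniteIntegral_iff_ofReal (ae_of_all _ fun _ => sq_nonneg _),
      lintegral_fst_piJoint hpr_meas hpr_nonneg (hK ε) (hK0 ε hε) (hK1 ε hε)
        (F := fun θ => ENNReal.ofReal (f θ ^ 2)) (by fun_prop)]
    exact hf2
  have hwm : Measurable fun p : T × Y => w φ d δ ε p.2 :=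
    (measurable_w hφ_meas hd_meas).comp measurable_snd
  have hdom : ∀ F : (T × Y) × (T × Y) → ℝ≥0∞, Measurable F → (∀ x, F (x, x) = 0) →
      ∫⁻ z, F z ∂(piJoint ν pr g φ d ε ⊗ₘ
          rejectionKernel (ν ⊗ₘ g) (acceptedDensity pr q φ d ε))
        ≤ ENNReal.ofReal (c ν pr g φ d δ / c ν pr g φ d ε) * ∫⁻ z, F z ∂(piJoint ν pr g φ d δ ⊗ₘ
          rejectionKernel (ν ⊗ₘ g) (acceptedDensity pr q φ d δ)) := by
    intro F hF hF0
    unfold piJoint at hprobδ hprobε ⊢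
    rw [lintegral_smul_withDensity_compProd_rejectionKernel (hs ε) (hs1 ε) (hD ε) _ hF,
      lintegral_smul_withDensity_compProd_rejectionKernel (hs δ) (hs1 δ) (hD δ) _ hF]
    simp only [hF0, mul_zero, lintegral_zero, add_zero]
    rw [ENNReal.ofReal_div_of_pos hcε, div_eq_mul_inv, ← mul_assoc,
      mul_right_comm (ENNReal.ofReal (c ν pr g φ d δ)),
      ENNReal.mul_inv_cancel (by simpa using hcδ) ENNReal.ofReal_ne_top, one_mul]
    simp only [mul_acceptedDensity hpr_nonneg hq_nonneg (hK0 ε hε),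
      mul_acceptedDensity hpr_nonneg hq_nonneg (hK0 δ hδ)]
    gcongr _ * ?_
    refine lintegral_mono fun x => lintegral_mono fun y => ?_
    refine mul_le_mul_left ?_ _
    refine ENNReal.ofReal_le_ofReal (min_le_min ?_ ?_)
    · exact mul_le_mul_of_nonneg_left (hK_le _) (mul_nonneg (hpr_nonneg _) (hq_nonneg _ _))
    · exact mul_le_mul_of_nonneg_left (hK_le _) (mul_nonneg (hpr_nonneg _) (hq_nonneg _ _))
  exact asymptoticVariance_comparison (hrev δ hδ hprobδ) (hrev ε hε hprobε) (div_pos hcδ hcε) hwm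
    (fun _ => hw0 _) (fun _ => hw1 _)
    (piJoint_eq_smul_withDensity hpr_meas hpr_nonneg hφ_meas hd_meas (hK0 δ hδ) hKw hcδ hcε)
    hdom (hMHmeas δ)
    (fun _ _ => MHop_eq_integral_rejectionKernel hpr_meas hpr_nonneg hq_meas hq_nonneg hq_prob
      (hK δ) (hK0 δ hδ))
    (hMHmeas ε)
    (fun _ _ => MHop_eq_integral_rejectionKernel hpr_meas hpr_nonneg hq_meas hq_nonneg hq_prob
      (hK ε) (hK0 ε hε))
    hfm hfL2 hsumδ hsumε
end
end

section
/- (Lemma on proposal augmentation, part (i).) Let (X,𝒳) be a measurable space, q a Markov kernel on X, and α: X×X → [0,1] jointly measurable. Define the proposal-rejection kernel L̇(x,dy) = q(x,dy) α(x,y) + (1 − ∫ q(x,dy') α(x,y')) δ_x(dy), and suppose L̇ is reversible with respect to a probability measure μ̇ (i.e., the measure μ̇(dx) L̇(x,dy) on X×X is invariant under swapping coordinates). Define the proposal-augmented kernel on X×X by L((x,x'), d(y,y')) = α(x,x') δ_{x'}(dy) q(x',dy') + (1 − α(x,x')) δ_x(dy) q(x,dy'). Then the probability measure μ(dx,dx')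 = μ̇(dx) q(x,dx') is invariant for L: μL = μ. -/
open MeasureTheory ProbabilityTheory
open scoped ENNReal

/-- The total mass of the proposal-rejection kernel is one. -/
lemma proposalRejection_univ {X : Type*} [MeasurableSpace X] (ν : Measure X)
    [IsProbabilityMeasure ν] (a : X → ℝ) (ha : Measurable a)
    (ha01 : ∀ y, a y ∈ Set.Icc (0 : ℝ) 1) (x : X) :
    (ν.withDensity (fun y => ENNReal.ofReal (a y))
        + ENNReal.ofReal (1 - ∫ y, a y ∂ν) • Measure.dirac x) Set.univ = 1 := by
  have hint : Integrable a ν := .of_mem_Icc 0 1 ha.aemeasurable (ae_of_all _ ha01)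
  have h0 : 0 ≤ ∫ y, a y ∂ν := integral_nonneg fun y => (ha01 y).1
  have h1 : ∫ y, a y ∂ν ≤ 1 := by
    simpa using integral_mono hint (integrable_const (1 : ℝ)) fun y => (ha01 y).2
  rw [Measure.add_apply, withDensity_apply _ .univ, Measure.restrict_univ,
    ← ofReal_integral_eq_lintegral_ofReal hint (ae_of_all _ fun y => (ha01 y).1),
    Measure.smul_apply, measure_univ, smul_eq_mul, mul_one,
    ← ENNReal.ofReal_add h0 (sub_nonneg.2 h1)]
  simp

/-- Integration against the proposal-rejection kernel averages over accepted and rejected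
proposals. -/
lemma lintegral_proposalRejection {X : Type*} [MeasurableSpace X] (ν : Measure X)
    [IsProbabilityMeasure ν] (a : X → ℝ) (ha : Measurable a)
    (ha01 : ∀ y, a y ∈ Set.Icc (0 : ℝ) 1) (x : X) (g : X → ℝ≥0∞) (hg : Measurable g) :
    ∫⁻ y, g y ∂(ν.withDensity (fun y => ENNReal.ofReal (a y))
        + ENNReal.ofReal (1 - ∫ y, a y ∂ν) • Measure.dirac x)
      = ∫⁻ y, (ENNReal.ofReal (a y) * g y + ENNReal.ofReal (1 - a y) * g x) ∂ν := by
  have hint : Integrable a ν := .of_mem_Icc 0 1 ha.aemeasurable (ae_of_all _ ha01)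
  have hrej : ENNReal.ofReal (1 - ∫ y, a y ∂ν) = ∫⁻ y, ENNReal.ofReal (1 - a y) ∂ν := by
    have hsub : Integrable (fun y => 1 - a y) ν := (integrable_const 1).sub hint
    rw [← ofReal_integral_eq_lintegral_ofReal hsub
      (ae_of_all _ fun y => sub_nonneg.2 (ha01 y).2), integral_sub (integrable_const 1) hint]
    simp
  rw [lintegral_add_measure, lintegral_smul_measure, lintegral_dirac' _ hg,
    lintegral_withDensity_eq_lintegral_mul _ ha.ennreal_ofReal hg,
    lintegral_add_left (f := fun y => ENNReal.ofReal (a y) * g y) (ha.ennreal_ofReal.mul hg),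
    lintegral_mul_const _ (by fun_prop), hrej]
  rfl

/-- Lemma on proposal augmentation, part (i):
if the proposal-rejection kernel `L̇` is `μ̇`-reversible, then
`μ(dx,dx') = μ̇(dx) q(x,dx')` is invariant for the proposal-augmented kernel `L`. -/
theorem stmt7 {X : Type*} [MeasurableSpace X]
    (q : Kernel X X) [IsMarkovKernel q]
    (α : X → X → ℝ) (hα_meas : Measurable (fun p : X × X => α p.1 p.2))
    (hα01 : ∀ x y, α x y ∈ Set.Icc (0 : ℝ) 1)
    -- the proposal-rejection kernel `L̇(x,dy) = q(x,dy)α(x,y) + (1-∫q(x,dy')α(x,y'))δ_x(dy)`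
    (Ldot : Kernel X X)
    (hLdot : ∀ x, Ldot x
      = (q x).withDensity (fun y => ENNReal.ofReal (α x y))
        + ENNReal.ofReal (1 - ∫ y, α x y ∂(q x)) • Measure.dirac x)
    -- `L̇` is reversible with respect to the probability measure `μ̇`
    (μdot : Measure X) [IsProbabilityMeasure μdot]
    (hrev : ∀ A B : Set X, MeasurableSet A → MeasurableSet B →
      ∫⁻ x in A, Ldot x B ∂μdot = ∫⁻ x in B, Ldot x A ∂μdot)
    -- the proposal-augmented kernel
    -- `L((x,x'),d(y,y')) = α(x,x')δ_{x'}(dy)q(x',dy') + (1-α(x,x'))δ_x(dy)q(x,dy')`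
    (L : Kernel (X × X) (X × X))
    (hL : ∀ p : X × X, L p
      = ENNReal.ofReal (α p.1 p.2) • ((Measure.dirac p.2).prod (q p.2))
        + ENNReal.ofReal (1 - α p.1 p.2) • ((Measure.dirac p.1).prod (q p.1))) :
    (μdot ⊗ₘ q).bind L = μdot ⊗ₘ q := by
  have hα (x : X) : Measurable (α x) := hα_meas.comp measurable_prodMk_left
  have hinv : μdot.bind Ldot = μdot := by
    ext A hA
    have h := hrev .univ A .univ hA
    rw [Measure.bind_apply hA Ldot.aemeasurable, ← setLIntegral_univ, h]
    simp_rw [hLdot, fun x => proposalRejection_univ (q x) (α x) (hα x) (hα01 x) x]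
    simp
  ext S hS
  have hg : Measurable fun x => q x (Prod.mk x ⁻¹' S) := Kernel.measurable_kernel_prodMk_left hS
  have hprod (x : X) : ((Measure.dirac x).prod (q x)) S = q x (Prod.mk x ⁻¹' S) := by
    rw [Measure.dirac_prod, Measure.map_apply measurable_prodMk_left hS]
  rw [Measure.bind_apply hS L.aemeasurable, Measure.lintegral_compProd (L.measurable_coe hS),
    Measure.compProd_apply hS]
  conv_rhs => rw [← hinv, Measure.lintegral_bind Ldot.aemeasurable hg.aemeasurable]
  refine lintegral_congr fun x => ?_
  rw [hLdot, lintegral_proposalRejection (q x) (α x) (hα x) (hα01 x) x _ hg]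
  simp only [hL, Measure.add_apply, Measure.smul_apply, smul_eq_mul, hprod]
end

section
/- (Averaging identity for the proposal-augmented kernel.) Let (X,𝒳) be a measurable space, q a Markov kernel on X, α: X×X → [0,1] jointly measurable, L̇(x,dy) = q(x,dy) α(x,y) + (1 − ∫ q(x,dy') α(x,y')) δ_x(dy), and let L be the proposal-augmented kernel on X×X, L((x,x'),d(y,y')) = α(x,x') δ_{x'}(dy) q(x',dy') + (1−α(x,x')) δ_x(dy) q(x,dy'). Then for every k ≥ 1, every bounded measurable f: X×X → ℝ, and every x ∈ X: ∫ q(x,dx') (L^k f)(x,x') = (L̇^k ḟ)(x), where ḟ(x) = ∫ f(x,x') q(x,dx'). Moreover, for k ≥ 1, L^k f(x,x') = α(x,x') (L̇^{k−1} ḟ)(x') + (1 − α(x,x')) (L̇^{k−1} ḟ)(x). -/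
open MeasureTheory ProbabilityTheory
open scoped ENNReal

noncomputable section

/-- `k`-step transition kernel: `kpow κ 0 = id`, `kpow κ (k+1) = κ ∘ₖ kpow κ k`. -/
def kpow {X : Type*} [MeasurableSpace X] (κ : Kernel X X) : ℕ → Kernel X X
  | 0 => Kernel.id
  | n + 1 => κ ∘ₖ kpow κ n

instance isMarkovKernel_kpow {X : Type*} [MeasurableSpace X] (κ : Kernel X X)
    [IsMarkovKernel κ] (n : ℕ) : IsMarkovKernel (kpow κ n) := by
  induction n with
  | zero => unfold kpow; infer_instance
  | succ n ih => unfold kpow; infer_instance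

theorem integrable_of_measurable_of_abs_le {X : Type*} [MeasurableSpace X] {μ : Measure X}
    [IsFiniteMeasure μ] {f : X → ℝ} (hf : Measurable f) {M : ℝ} (hM : ∀ x, |f x| ≤ M) :
    Integrable f μ :=
  Integrable.of_bound hf.aestronglyMeasurable M (Filter.Eventually.of_forall hM)

theorem abs_integral_le_of_abs_le {X : Type*} [MeasurableSpace X] {μ : Measure X}
    [IsProbabilityMeasure μ] {f : X → ℝ} {M : ℝ} (hM : ∀ x, |f x| ≤ M) :
    |∫ x, f x ∂μ| ≤ M := by
  simpa using norm_integral_le_of_norm_le_const (μ := μ) (f := f)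
    (Filter.Eventually.of_forall hM)

theorem integral_kpow_succ {X : Type*} [MeasurableSpace X] (κ : Kernel X X) [IsMarkovKernel κ]
    (n : ℕ) (x : X) {f : X → ℝ} (hf : Measurable f) {M : ℝ} (hM : ∀ x, |f x| ≤ M) :
    ∫ z, f z ∂(kpow κ (n + 1) x) = ∫ y, (∫ z, f z ∂(κ y)) ∂(kpow κ n x) :=
  Kernel.integral_comp
    (show Integrable f ((κ ∘ₖ kpow κ n) x) from integrable_of_measurable_of_abs_le hf hM)

theorem integral_smul_dirac_prod_add {X : Type*} [MeasurableSpace X] (μ ν : Measure X)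
    [IsProbabilityMeasure μ] [IsProbabilityMeasure ν] (x y : X) {a : ℝ} (ha : a ∈ Set.Icc (0 : ℝ) 1)
    {f : X × X → ℝ} (hf : Measurable f) {M : ℝ} (hM : ∀ p, |f p| ≤ M) :
    ∫ z, f z ∂(ENNReal.ofReal a • ((Measure.dirac x).prod μ)
        + ENNReal.ofReal (1 - a) • ((Measure.dirac y).prod ν))
      = a * ∫ z, f (x, z) ∂μ + (1 - a) * ∫ z, f (y, z) ∂ν := by
  rw [integral_add_measure
    ((integrable_of_measurable_of_abs_le hf hM).smul_measure ENNReal.ofReal_ne_top)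
    ((integrable_of_measurable_of_abs_le hf hM).smul_measure ENNReal.ofReal_ne_top),
    integral_smul_measure, integral_smul_measure, Measure.dirac_prod, Measure.dirac_prod,
    integral_map measurable_prodMk_left.aemeasurable hf.aestronglyMeasurable,
    integral_map measurable_prodMk_left.aemeasurable hf.aestronglyMeasurable,
    ENNReal.toReal_ofReal ha.1, ENNReal.toReal_ofReal (sub_nonneg.2 ha.2), smul_eq_mul,
    smul_eq_mul]

theorem integral_withDensity_add_smul_dirac {X : Type*} [MeasurableSpace X] (μ : Measure X)
    [IsProbabilityMeasure μ] (x : X) {a : X → ℝ} (ha : Measurable a)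
    (ha01 : ∀ y, a y ∈ Set.Icc (0 : ℝ) 1) {h : X → ℝ} (hh : Measurable h) {M : ℝ}
    (hM : ∀ y, |h y| ≤ M) :
    ∫ y, h y ∂(μ.withDensity (fun y => ENNReal.ofReal (a y))
        + ENNReal.ofReal (1 - ∫ y, a y ∂μ) • Measure.dirac x)
      = ∫ y, (a y * h y + (1 - a y) * h x) ∂μ := by
  have ha_abs : ∀ y, |a y| ≤ 1 := fun y => abs_le.2 ⟨by linarith [(ha01 y).1], (ha01 y).2⟩
  have hai : Integrable a μ := integrable_of_measurable_of_abs_le ha ha_abs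
  have hle : ∫ y, a y ∂μ ≤ 1 := (abs_le.1 (abs_integral_le_of_abs_le ha_abs)).2
  have hahi : Integrable (fun y => a y * h y) μ :=
    (integrable_of_measurable_of_abs_le hh hM).bdd_mul ha.aestronglyMeasurable
      (Filter.Eventually.of_forall ha_abs)
  have h1ai : Integrable (fun y => (1 - a y) * h x) μ :=
    ((integrable_const 1).sub hai).mul_const _
  have : IsFiniteMeasure (μ.withDensity (fun y => ENNReal.ofReal (a y))) :=
    isFiniteMeasure_withDensity_ofReal hai.2
  rw [integral_add_measure (integrable_of_measurable_of_abs_le hh hM)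
    ((integrable_of_measurable_of_abs_le hh hM).smul_measure ENNReal.ofReal_ne_top),
    integral_smul_measure, integral_dirac' _ _ hh.stronglyMeasurable,
    ENNReal.toReal_ofReal (sub_nonneg.2 hle),
    integral_withDensity_eq_integral_toReal_smul ha.ennreal_ofReal
      (Filter.Eventually.of_forall fun _ => ENNReal.ofReal_lt_top),
    integral_add hahi h1ai, integral_mul_const,
    integral_sub (integrable_const 1) hai]
  simp [ENNReal.toReal_ofReal (ha01 _).1]

/-- averaging identity for the proposal-augmented kernel:
`∫ q(x,dx') (L^k f)(x,x') = (L̇^k ḟ)(x)` with `ḟ(x) = ∫ f(x,x') q(x,dx')`, and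
`L^k f(x,x') = α(x,x') (L̇^{k-1} ḟ)(x') + (1-α(x,x')) (L̇^{k-1} ḟ)(x)` for `k ≥ 1`. -/
theorem stmt9 {X : Type*} [MeasurableSpace X]
    (q : Kernel X X) [IsMarkovKernel q]
    (α : X → X → ℝ) (hα_meas : Measurable (fun p : X × X => α p.1 p.2))
    (hα01 : ∀ x y, α x y ∈ Set.Icc (0 : ℝ) 1)
    (Ldot : Kernel X X) [IsMarkovKernel Ldot]
    (hLdot : ∀ x, Ldot x
      = (q x).withDensity (fun y => ENNReal.ofReal (α x y))
        + ENNReal.ofReal (1 - ∫ y, α x y ∂(q x)) • Measure.dirac x)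
    (L : Kernel (X × X) (X × X)) [IsMarkovKernel L]
    (hL : ∀ p : X × X, L p
      = ENNReal.ofReal (α p.1 p.2) • ((Measure.dirac p.2).prod (q p.2))
        + ENNReal.ofReal (1 - α p.1 p.2) • ((Measure.dirac p.1).prod (q p.1))) :
    ∀ k : ℕ, 1 ≤ k → ∀ f : X × X → ℝ, Measurable f → ∀ M : ℝ, (∀ p, |f p| ≤ M) →
      (∀ x : X,
        ∫ x', (∫ z, f z ∂(kpow L k (x, x'))) ∂(q x)
          = ∫ y, (∫ y', f (y, y') ∂(q y)) ∂(kpow Ldot k x)) ∧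
      (∀ x x' : X,
        ∫ z, f z ∂(kpow L k (x, x'))
          = α x x' * (∫ y, (∫ y', f (y, y') ∂(q y)) ∂(kpow Ldot (k - 1) x'))
            + (1 - α x x') * (∫ y, (∫ y', f (y, y') ∂(q y)) ∂(kpow Ldot (k - 1) x))) := by
  have hdot_meas : ∀ f : X × X → ℝ, Measurable f → Measurable fun y => ∫ y', f (y, y') ∂(q y) :=
    fun f hf => (StronglyMeasurable.integral_kernel_prod_right' (κ := q)
      hf.stronglyMeasurable).measurable
  have hdot_abs : ∀ (f : X × X → ℝ) (M : ℝ), (∀ p, |f p| ≤ M) →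
      ∀ y, |∫ y', f (y, y') ∂(q y)| ≤ M :=
    fun f M hM y => abs_integral_le_of_abs_le fun y' => hM (y, y')
  have hL_int : ∀ f : X × X → ℝ, Measurable f → ∀ M : ℝ, (∀ p, |f p| ≤ M) → ∀ p : X × X,
      ∫ z, f z ∂(L p) = α p.1 p.2 * (∫ y', f (p.2, y') ∂(q p.2))
        + (1 - α p.1 p.2) * (∫ y', f (p.1, y') ∂(q p.1)) := by
    intro f hf M hM p
    rw [hL]
    exact integral_smul_dirac_prod_add _ _ _ _ (hα01 _ _) hf hM
  have hL_meas : ∀ f : X × X → ℝ, Measurable f → Measurable fun p => ∫ z, f z ∂(L p) :=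
    fun f hf => (StronglyMeasurable.integral_kernel (κ := L) hf.stronglyMeasurable).measurable
  have hL_abs : ∀ (f : X × X → ℝ) (M : ℝ), (∀ p, |f p| ≤ M) → ∀ p, |∫ z, f z ∂(L p)| ≤ M :=
    fun f M hM p => abs_integral_le_of_abs_le hM
  have hdot_L : ∀ f : X × X → ℝ, Measurable f → ∀ M : ℝ, (∀ p, |f p| ≤ M) → ∀ y : X,
      ∫ y', (∫ z, f z ∂(L (y, y'))) ∂(q y)
        = ∫ z, (∫ z', f (z, z') ∂(q z)) ∂(Ldot y) := by
    intro f hf M hM y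
    rw [hLdot, integral_withDensity_add_smul_dirac (a := α y) (q y) y
      (hα_meas.comp measurable_prodMk_left) (hα01 y) (hdot_meas f hf) (hdot_abs f M hM)]
    exact integral_congr_ae (Filter.Eventually.of_forall fun y' => hL_int f hf M hM (y, y'))
  have hdot_kpow : ∀ (n : ℕ) (f : X × X → ℝ), Measurable f → ∀ M : ℝ, (∀ p, |f p| ≤ M) → ∀ x : X,
      ∫ y, (∫ y', (∫ z, f z ∂(L (y, y'))) ∂(q y)) ∂(kpow Ldot n x)
        = ∫ y, (∫ y', f (y, y') ∂(q y)) ∂(kpow Ldot (n + 1) x) := by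
    intro n f hf M hM x
    rw [integral_kpow_succ Ldot n x (hdot_meas f hf) (hdot_abs f M hM)]
    simp_rw [hdot_L f hf M hM]
  have averaging : ∀ (k : ℕ) (f : X × X → ℝ), Measurable f → ∀ M : ℝ, (∀ p, |f p| ≤ M) → ∀ x : X,
      ∫ x', (∫ z, f z ∂(kpow L k (x, x'))) ∂(q x)
        = ∫ y, (∫ y', f (y, y') ∂(q y)) ∂(kpow Ldot k x) := by
    intro k
    induction k with
    | zero =>
      intro f hf M hM x
      simp only [kpow, Kernel.id_apply]
      rw [integral_dirac' _ _ (hdot_meas f hf).stronglyMeasurable]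
      simp_rw [integral_dirac' _ _ hf.stronglyMeasurable]
    | succ n ih =>
      intro f hf M hM x
      simp_rw [integral_kpow_succ L n _ hf hM]
      rw [ih _ (hL_meas f hf) M (hL_abs f M hM), hdot_kpow n f hf M hM]
  intro k hk f hf M hM
  refine ⟨averaging k f hf M hM, ?_⟩
  induction k, hk using Nat.le_induction generalizing f with
  | base =>
    intro x x'
    rw [integral_kpow_succ L 0 _ hf hM]
    simp only [kpow, Kernel.id_apply, Nat.sub_self]
    rw [integral_dirac' _ _ (hL_meas f hf).stronglyMeasurable,
      integral_dirac' _ _ (hdot_meas f hf).stronglyMeasurable,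
      integral_dirac' _ _ (hdot_meas f hf).stronglyMeasurable]
    exact hL_int f hf M hM (x, x')
  | succ n hn ih =>
    intro x x'
    obtain ⟨m, rfl⟩ := Nat.exists_eq_add_of_le' hn
    rw [integral_kpow_succ L (m + 1) _ hf hM, ih _ (hL_meas f hf) (hL_abs f M hM)]
    simp only [Nat.add_sub_cancel]
    rw [hdot_kpow m f hf M hM, hdot_kpow m f hf M hM]
end
end

section
/- (Lemma on contractions, part (i): kernel Lipschitz bound.) Assume the adaptive ABC setting with each Q_θ admitting a density bounded by C_Q uniformly in θ. Let P_β be the proposal-augmented kernel on T×T: P_β((θ,θ'), d(ϑ,ϑ')) = α_β(θ,θ') δ_{θ'}(dϑ) q(θ',ϑ') dϑ' + (1 − α_β(θ,θ')) δ_θ(dϑ) q(θ,ϑ') dϑ', with α_β(θ,ϑ) = α̇(θ,ϑ) L_β(ϑ). Then for all β₁, β₂ ∈ ℝ and every bounded measurable g: T×T → ℝ, sup_{(θ,θ')} |P_{β₁}g(θ,θ') − P_{β₂}g(θ,θ')| ≤ 2 C_Q ‖g‖_∞ |e^{β₁} − e^{β₂}|. -/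
open MeasureTheory ProbabilityTheory
open scoped ENNReal

noncomputable section

namespace Adapt

variable {E : Type*} [MeasureSpace E]

/-- `L_β(θ) = Q_θ([0, e^β])`. -/
def Lb (Q : E → Measure ℝ) (β : ℝ) (θ : E) : ℝ :=
  (Q θ (Set.Icc 0 (Real.exp β))).toReal

/-- `c_β = ∫ pr(θ) L_β(θ) dθ`. -/
def cb (pr : E → ℝ) (Q : E → Measure ℝ) (β : ℝ) : ℝ :=
  ∫ θ, pr θ * Lb Q β θ

/-- `α̇(θ,ϑ) = min{1, pr(ϑ)q(ϑ,θ)/(pr(θ)q(θ,ϑ))}`. -/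
def alphadot (pr : E → ℝ) (q : E → E → ℝ) (θ ϑ : E) : ℝ :=
  min 1 (pr ϑ * q ϑ θ / (pr θ * q θ ϑ))

end Adapt

open Adapt

/-- The proposal-augmented kernel `P_β` acting on functions:
`P_β g(θ,θ') = α_β(θ,θ') ∫ g(θ',ϑ') q(θ',ϑ') dϑ' + (1-α_β(θ,θ')) ∫ g(θ,ϑ') q(θ,ϑ') dϑ'`
with `α_β(θ,ϑ) = α̇(θ,ϑ) L_β(ϑ)`. -/
noncomputable def Pop {E : Type*} [MeasureSpace E]
    (pr : E → ℝ) (q : E → E → ℝ) (Q : E → Measure ℝ) (β : ℝ)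
    (g : E × E → ℝ) : E × E → ℝ :=
  fun z =>
    alphadot pr q z.1 z.2 * Lb Q β z.2 * (∫ ϑ', q z.2 ϑ' * g (z.2, ϑ'))
      + (1 - alphadot pr q z.1 z.2 * Lb Q β z.2) * (∫ ϑ', q z.1 ϑ' * g (z.1, ϑ'))

/-- Averaging a function bounded by `M` against a probability density gives at most `M`. -/
theorem abs_integral_density_mul_le {E : Type*} [MeasurableSpace E] {μ : Measure E}
    {f h : E → ℝ} {M : ℝ} (hf_nonneg : ∀ x, 0 ≤ f x) (hf_one : ∫ x, f x ∂μ = 1)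
    (hh : ∀ x, |h x| ≤ M) : |∫ x, f x * h x ∂μ| ≤ M := by
  have hf : Integrable f μ := .of_integral_ne_zero (by simp [hf_one])
  have hle : ‖∫ x, f x * h x ∂μ‖ ≤ ∫ x, f x * M ∂μ :=
    norm_integral_le_of_norm_le (hf.mul_const M) (.of_forall fun x => by
      rw [Real.norm_eq_abs, abs_mul, abs_of_nonneg (hf_nonneg x)]
      exact mul_le_mul_of_nonneg_left (hh x) (hf_nonneg x))
  rwa [integral_mul_const, hf_one, one_mul] at hle

/-- The distribution function of a finite measure with density at most `C` is
`C`-Lipschitz. -/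
theorem abs_measureReal_Icc_sub_le {μ : Measure ℝ} [IsFiniteMeasure μ] {d : ℝ → ℝ} {C : ℝ}
    (hC : 0 ≤ C) (hd : ∀ t, d t ≤ C)
    (hμ : μ = volume.withDensity fun t => ENNReal.ofReal (d t)) (x a b : ℝ) :
    |μ.real (Set.Icc x a) - μ.real (Set.Icc x b)| ≤ C * |a - b| := by
  wlog hab : b ≤ a generalizing a b
  · rw [abs_sub_comm, abs_sub_comm a]
    exact this b a (le_of_not_ge hab)
  have hmono : μ.real (Set.Icc x b) ≤ μ.real (Set.Icc x a) :=
    measureReal_mono (Set.Icc_subset_Icc_right hab)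
  have hcover : Set.Icc x a ⊆ Set.Icc x b ∪ Set.Ioc b a := fun t ht =>
    (le_or_gt t b).imp (fun h => ⟨ht.1, h⟩) fun h => ⟨h, ht.2⟩
  have hsub : μ.real (Set.Icc x a) ≤ μ.real (Set.Icc x b) + μ.real (Set.Ioc b a) :=
    (measureReal_mono hcover).trans (measureReal_union_le _ _)
  have hIoc : μ.real (Set.Ioc b a) ≤ C * (a - b) := by
    refine ENNReal.toReal_le_of_le_ofReal (mul_nonneg hC (sub_nonneg.2 hab)) ?_
    rw [hμ, withDensity_apply _ measurableSet_Ioc, ENNReal.ofReal_mul hC, ← Real.volume_Ioc,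
      ← setLIntegral_const]
    exact lintegral_mono fun t => ENNReal.ofReal_le_ofReal (hd t)
  rw [abs_of_nonneg (sub_nonneg.2 hmono), abs_of_nonneg (sub_nonneg.2 hab)]
  linarith

theorem abs_alphadot_le_one {E : Type*} [MeasureSpace E] {pr : E → ℝ} {q : E → E → ℝ}
    (hpr : ∀ θ, 0 ≤ pr θ) (hq : ∀ θ ϑ, 0 ≤ q θ ϑ) (θ ϑ : E) : |alphadot pr q θ ϑ| ≤ 1 := by
  have hnonneg : 0 ≤ alphadot pr q θ ϑ := le_min zero_le_one <|
    div_nonneg (mul_nonneg (hpr _) (hq _ _)) (mul_nonneg (hpr _) (hq _ _))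
  rw [abs_of_nonneg hnonneg]
  exact min_le_left _ _

/-- Changing `β` only changes the weight put on the two proposal averages. -/
theorem Pop_sub_Pop {E : Type*} [MeasureSpace E] (pr : E → ℝ) (q : E → E → ℝ)
    (Q : E → Measure ℝ) (β₁ β₂ : ℝ) (g : E × E → ℝ) (θ θ' : E) :
    Pop pr q Q β₁ g (θ, θ') - Pop pr q Q β₂ g (θ, θ') =
      alphadot pr q θ θ' * (Lb Q β₁ θ' - Lb Q β₂ θ') *
        ((∫ ϑ, q θ' ϑ * g (θ', ϑ)) - ∫ ϑ, q θ ϑ * g (θ, ϑ)) := by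
  simp only [Pop]
  ring

/-- Lemma on contractions, part (i): kernel Lipschitz bound. -/
theorem stmt11 (p : ℕ) (T : Set (Fin p → ℝ)) (hT_open : IsOpen T) (hT_ne : T.Nonempty)
    (pr : (Fin p → ℝ) → ℝ) (hpr_meas : Measurable pr) (hpr_nonneg : ∀ θ, 0 ≤ pr θ)
    (hpr_prob : ∫ θ, pr θ = 1)
    (Cpr : ℝ) (hpr_bdd : ∀ θ, pr θ ≤ Cpr)
    (hpr_supp : ∀ θ, θ ∉ T → pr θ = 0)
    (q : (Fin p → ℝ) → (Fin p → ℝ) → ℝ)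
    (hq_meas : Measurable (fun z : (Fin p → ℝ) × (Fin p → ℝ) => q z.1 z.2))
    (hq_nonneg : ∀ θ ϑ, 0 ≤ q θ ϑ)
    (hq_prob : ∀ θ, ∫ ϑ, q θ ϑ = 1)
    (Q : (Fin p → ℝ) → Measure ℝ) (hQ_meas : Measurable Q)
    (hQ_prob : ∀ θ, IsProbabilityMeasure (Q θ))
    (hQ_supp : ∀ θ, Q θ (Set.Iio 0) = 0)
    (Qd : (Fin p → ℝ) → ℝ → ℝ) (CQ : ℝ)
    (hQd_nonneg : ∀ θ t, 0 ≤ Qd θ t) (hQd_bdd : ∀ θ t, Qd θ t ≤ CQ)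
    (hQd : ∀ θ, Q θ = volume.withDensity (fun t => ENNReal.ofReal (Qd θ t))) :
    ∀ β₁ β₂ : ℝ, ∀ g : (Fin p → ℝ) × (Fin p → ℝ) → ℝ, Measurable g →
      ∀ M : ℝ, (∀ z, |g z| ≤ M) →
      ∀ θ θ' : Fin p → ℝ,
        |Pop pr q Q β₁ g (θ, θ') - Pop pr q Q β₂ g (θ, θ')|
          ≤ 2 * CQ * M * |Real.exp β₁ - Real.exp β₂| := by
  intro β₁ β₂ g _ M hM θ θ'
  have := hQ_prob θ'
  have hCQ : 0 ≤ CQ := (hQd_nonneg θ 0).trans (hQd_bdd θ 0)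
  have hL : |Lb Q β₁ θ' - Lb Q β₂ θ'| ≤ CQ * |Real.exp β₁ - Real.exp β₂| :=
    abs_measureReal_Icc_sub_le hCQ (hQd_bdd θ') (hQd θ') 0 _ _
  have hI (ϑ : Fin p → ℝ) : |∫ ϑ', q ϑ ϑ' * g (ϑ, ϑ')| ≤ M :=
    abs_integral_density_mul_le (hq_nonneg ϑ) (hq_prob ϑ) fun ϑ' => hM (ϑ, ϑ')
  rw [Pop_sub_Pop, abs_mul, abs_mul]
  calc
    _ ≤ 1 * (CQ * |Real.exp β₁ - Real.exp β₂|) * (M + M) := by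
      gcongr
      · exact abs_alphadot_le_one hpr_nonneg hq_nonneg θ θ'
      · exact (abs_sub _ _).trans (add_le_add (hI θ') (hI θ))
    _ = 2 * CQ * M * |Real.exp β₁ - Real.exp β₂| := by ring
end
end
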